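/- arXiv:2012.12348 — 3 statements merged into one kernel-verified Lean document; each statement's English description precedes it below -/
import Mathlib

section
/- Let d ∈ ℕ, let T, ρ ∈ (0,∞), set ϱ = √(2ρT), let a ∈ ℝ, b ∈ (a,∞), let φ: ℝ^d → ℝ be a function, let u ∈ C^{1,2}([0,T]×ℝ^d, ℝ) be a function with at most polynomially growing partial derivatives which satisfies for every t ∈ [0,T], x ∈ ℝ^d that u(0,x) = φ(x) and ∂u/∂t(t,x) = ρ Δ_x u(t,x), let (Ω,𝔽,ℙ) be a probability space, let 𝕎: Ω → ℝ^d be a standard normal random variable (law equal to the standard Gaussian measure on ℝ^d), let ξ: Ω → [a,b]^d be a uniformly distributed random variable on [a,b]^d, and assume that 𝕎 and ξ are independent. Then there exists a unique continuous function U: [a,b]^d → ℝ such that E[|φ(ϱ𝕎 + ξ) − U(ξ)|²] = inf_{v ∈ C([a,b]^d,ℝ)} E[|φ(ϱ𝕎 + ξ) − v(ξ)|²]. -/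
open MeasureTheory ProbabilityTheory Set

noncomputable section

/-- First spatial partial derivative `∂g/∂x_i` of a function `g : ℝ^d → ℝ`. -/
def spatialPD1 (d : ℕ) (g : (Fin d → ℝ) → ℝ) (i : Fin d) (x : Fin d → ℝ) : ℝ :=
  fderiv ℝ g x (Pi.single i 1)

/-- Second spatial partial derivative `∂²g/(∂x_i ∂x_j)` of a function `g : ℝ^d → ℝ`. -/
def spatialPD2 (d : ℕ) (g : (Fin d → ℝ) → ℝ) (i j : Fin d) (x : Fin d → ℝ) : ℝ :=
  fderiv ℝ (fun y => fderiv ℝ g y (Pi.single i 1)) x (Pi.single j 1)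

/-- The Laplacian `Δg` of a function `g : ℝ^d → ℝ`. -/
def laplacian (d : ℕ) (g : (Fin d → ℝ) → ℝ) (x : Fin d → ℝ) : ℝ :=
  ∑ i : Fin d, spatialPD2 d g i i x

/-- `u ∈ C^{1,2}([α,β] × ℝ^d, ℝ)`: `u` is continuous, once continuously differentiable in
the time variable and twice continuously differentiable in the space variable, with all
partial derivatives jointly continuous. -/
def IsC12On (d : ℕ) (α β : ℝ) (u : ℝ → (Fin d → ℝ) → ℝ) : Prop :=
  ContinuousOn (fun p : ℝ × (Fin d → ℝ) => u p.1 p.2) (Icc α β ×ˢ univ) ∧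
  (∀ x, DifferentiableOn ℝ (fun t => u t x) (Icc α β)) ∧
  ContinuousOn (fun p : ℝ × (Fin d → ℝ) =>
    derivWithin (fun s => u s p.2) (Icc α β) p.1) (Icc α β ×ˢ univ) ∧
  (∀ t ∈ Icc α β, ContDiff ℝ 2 (u t)) ∧
  (∀ i : Fin d, ContinuousOn (fun p : ℝ × (Fin d → ℝ) => spatialPD1 d (u p.1) i p.2)
    (Icc α β ×ˢ univ)) ∧
  (∀ i j : Fin d, ContinuousOn (fun p : ℝ × (Fin d → ℝ) => spatialPD2 d (u p.1) i j p.2)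
    (Icc α β ×ˢ univ))

/-- `u` and its time derivative and first and second order spatial partial derivatives grow
at most polynomially on `[0,T] × ℝ^d`. -/
def HasPolyGrowthDerivs (d : ℕ) (T : ℝ) (u : ℝ → (Fin d → ℝ) → ℝ) : Prop :=
  ∃ c q : ℝ, 1 ≤ q ∧ ∀ t ∈ Icc (0:ℝ) T, ∀ x : Fin d → ℝ,
    |u t x| ≤ c * (1 + ∑ i, |x i|) ^ q ∧
    |derivWithin (fun s => u s x) (Icc (0:ℝ) T) t| ≤ c * (1 + ∑ i, |x i|) ^ q ∧
    (∀ i, |spatialPD1 d (u t) i x| ≤ c * (1 + ∑ i, |x i|) ^ q) ∧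
    (∀ i j, |spatialPD2 d (u t) i j x| ≤ c * (1 + ∑ i, |x i|) ^ q)

/-- The standard Gaussian measure on `ℝ^d` (the `d`-fold product of the standard
Gaussian measure on `ℝ`). -/
def stdGaussian (d : ℕ) : Measure (Fin d → ℝ) :=
  Measure.pi fun _ => gaussianReal 0 1

/-- The cube `[a,b]^d ⊆ ℝ^d`. -/
def cube (d : ℕ) (a b : ℝ) : Set (Fin d → ℝ) :=
  Set.univ.pi fun _ => Icc a b

/-- The uniform distribution on the cube `[a,b]^d`, i.e. normalized Lebesgue measure. -/
def uniformCube (d : ℕ) (a b : ℝ) : Measure (Fin d → ℝ) :=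
  (volume (cube d a b))⁻¹ • volume.restrict (cube d a b)

open scoped ENNReal NNReal

lemma isCompact_cube (d : ℕ) (a b : ℝ) : IsCompact (cube d a b) :=
  isCompact_univ_pi fun _ => isCompact_Icc

lemma measurableSet_cube (d : ℕ) (a b : ℝ) : MeasurableSet (cube d a b) :=
  (isCompact_cube d a b).measurableSet

lemma closure_interior_cube {a b : ℝ} (d : ℕ) (hab : a < b) :
    closure (interior (cube d a b)) = cube d a b := by
  rw [cube, interior_pi_set Set.finite_univ, closure_pi_set]
  simp only [interior_Icc, closure_Ioo hab.ne]

instance isProbabilityMeasure_stdGaussian (d : ℕ) :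
    IsProbabilityMeasure (_root_.stdGaussian d) := by
  unfold _root_.stdGaussian; infer_instance

lemma ae_restrict_of_ae_uniformCube {d : ℕ} {a b : ℝ} {p : (Fin d → ℝ) → Prop}
    (h : ∀ᵐ x ∂uniformCube d a b, p x) : ∀ᵐ x ∂volume.restrict (cube d a b), p x :=
  (Measure.ae_ennreal_smul_measure_iff
    (ENNReal.inv_ne_zero.2 (isCompact_cube d a b).measure_lt_top.ne)).1 h

lemma memLp_polynomial_stdGaussian (d : ℕ) {c r R q : ℝ} (hR : 0 ≤ R) (hq : 0 < q) :
    MemLp (fun w : Fin d → ℝ => c * (1 + R + ∑ i, |r * w i|) ^ q) 2 (stdGaussian d) := by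
  set p : ℝ≥0∞ := 2 * ENNReal.ofReal q
  have hp : p ≠ ∞ := ENNReal.mul_ne_top (by simp) (by simp)
  have hcoord (i : Fin d) : MemLp (fun w : Fin d → ℝ => |r * w i|) p (stdGaussian d) :=
    (((memLp_id_gaussianReal' p hp).comp_measurePreserving
      (measurePreserving_eval (fun _ : Fin d => gaussianReal 0 1) i)).const_mul r).norm
  have hbase : MemLp (fun w : Fin d → ℝ => 1 + R + ∑ i, |r * w i|) p (stdGaussian d) :=
    (memLp_const (1 + R)).add (memLp_finsetSum _ fun i _ => hcoord i)
  have hpow := hbase.norm_rpow_div (ENNReal.ofReal q)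
  rw [ENNReal.mul_div_cancel_right (by simpa using hq) (by simp),
    ENNReal.toReal_ofReal hq.le] at hpow
  refine (hpow.const_mul c).congr_norm ?_ (Filter.Eventually.of_forall fun w => ?_)
  · refine (Continuous.aestronglyMeasurable ?_)
    exact continuous_const.mul (Continuous.rpow_const (by fun_prop) fun _ => Or.inr hq.le)
  · rw [Real.norm_of_nonneg (by positivity : 0 ≤ 1 + R + ∑ i, |r * w i|)]

lemma abs_shift_le_of_growth {d : ℕ} {φ : (Fin d → ℝ) → ℝ} {c q : ℝ} (hq : 0 ≤ q)
    (hφ : ∀ y, |φ y| ≤ c * (1 + ∑ i, |y i|) ^ q) {R : ℝ} (r : ℝ) (w x : Fin d → ℝ)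
    (hx : ∑ i, |x i| ≤ R) :
    |φ (r • w + x)| ≤ c * (1 + R + ∑ i, |r * w i|) ^ q := by
  have hc : 0 ≤ c := by simpa using (abs_nonneg _).trans (hφ 0)
  refine (hφ _).trans ?_
  refine mul_le_mul_of_nonneg_left (Real.rpow_le_rpow (by positivity) ?_ hq) hc
  calc 1 + ∑ i, |(r • w + x) i| ≤ 1 + ∑ i, (|r * w i| + |x i|) := by
        gcongr with i
        exact abs_add_le _ _
    _ ≤ 1 + R + ∑ i, |r * w i| := by
        rw [Finset.sum_add_distrib]; linarith

lemma exists_sum_abs_le_of_mem_cube (d : ℕ) (a b : ℝ) :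
    ∃ R : ℝ, 0 ≤ R ∧ ∀ x ∈ cube d a b, ∑ i, |x i| ≤ R := by
  obtain ⟨R, hR⟩ := (isCompact_cube d a b).exists_bound_of_continuousOn
    (f := fun x : Fin d → ℝ => ∑ i, |x i|) (by fun_prop)
  exact ⟨max R 0, le_max_right _ _, fun x hx =>
    ((le_abs_self _).trans (hR x hx)).trans (le_max_left _ _)⟩

lemma integrable_shift_stdGaussian {d : ℕ} {φ : (Fin d → ℝ) → ℝ} {c q : ℝ} (hq : 0 < q)
    (hcont : Continuous φ) (hφ : ∀ y, |φ y| ≤ c * (1 + ∑ i, |y i|) ^ q) (r : ℝ)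
    (x : Fin d → ℝ) : Integrable (fun w => φ (r • w + x)) (stdGaussian d) :=
  ((memLp_polynomial_stdGaussian d (by positivity) hq).integrable one_le_two).mono'
    (hcont.comp (by fun_prop)).aestronglyMeasurable
    (Filter.Eventually.of_forall fun w => abs_shift_le_of_growth hq.le hφ r w x le_rfl)

lemma continuousOn_integral_shift_stdGaussian {d : ℕ} {φ : (Fin d → ℝ) → ℝ} {c q : ℝ}
    (hq : 0 < q) (hcont : Continuous φ) (hφ : ∀ y, |φ y| ≤ c * (1 + ∑ i, |y i|) ^ q)
    (r a b : ℝ) :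
    ContinuousOn (fun x => ∫ w, φ (r • w + x) ∂stdGaussian d) (cube d a b) := by
  obtain ⟨R, hR, hsum⟩ := exists_sum_abs_le_of_mem_cube d a b
  exact continuousOn_of_dominated
    (fun x _ => (hcont.comp (by fun_prop)).aestronglyMeasurable)
    (fun x hx => Filter.Eventually.of_forall fun w =>
      abs_shift_le_of_growth hq.le hφ r w x (hsum x hx))
    ((memLp_polynomial_stdGaussian d hR hq).integrable one_le_two)
    (Filter.Eventually.of_forall fun w => (hcont.comp (by fun_prop)).continuousOn)

section Probability

variable {Ω : Type*} [MeasurableSpace Ω] {P : Measure Ω}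

lemma memLp_comp_of_continuousOn_cube [IsFiniteMeasure P] {d : ℕ} {a b : ℝ} {ξ : Ω → Fin d → ℝ}
    (hξ : Measurable ξ) (hξval : ∀ ω, ξ ω ∈ cube d a b) {v : (Fin d → ℝ) → ℝ}
    (hv : ContinuousOn v (cube d a b)) : MemLp (fun ω => v (ξ ω)) 2 P := by
  obtain ⟨C, hC⟩ := (isCompact_cube d a b).exists_bound_of_continuousOn hv
  have hmeas : Measurable fun ω => v (ξ ω) :=
    (continuousOn_iff_continuous_domRestrict.1 hv).measurable.comp (hξ.subtype_mk (h := hξval))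
  exact .of_bound hmeas.aestronglyMeasurable C
    (Filter.Eventually.of_forall fun ω => hC _ (hξval ω))

lemma integral_sq_sub_of_integral_mul_eq_zero {X G V : Ω → ℝ} (hX : MemLp X 2 P)
    (hG : MemLp G 2 P) (hV : MemLp V 2 P) (h : ∫ ω, (X ω - G ω) * (G ω - V ω) ∂P = 0) :
    ∫ ω, |X ω - V ω| ^ 2 ∂P = ∫ ω, |X ω - G ω| ^ 2 ∂P + ∫ ω, (G ω - V ω) ^ 2 ∂P := by
  have h1 : Integrable (fun ω => (X ω - G ω) ^ 2) P := (hX.sub hG).integrable_sq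
  have h2 : Integrable (fun ω => (G ω - V ω) ^ 2) P := (hG.sub hV).integrable_sq
  have h3 : Integrable (fun ω => (X ω - G ω) * (G ω - V ω)) P :=
    (hX.sub hG).integrable_mul (hG.sub hV)
  have h4 : Integrable (fun ω => (G ω - V ω) ^ 2 + 2 * ((X ω - G ω) * (G ω - V ω))) P :=
    h2.add (h3.const_mul 2)
  simp only [sq_abs]
  calc ∫ ω, (X ω - V ω) ^ 2 ∂P
      = ∫ ω, (X ω - G ω) ^ 2 + ((G ω - V ω) ^ 2 + 2 * ((X ω - G ω) * (G ω - V ω))) ∂P := by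
        congr with ω; ring
    _ = _ := by
        rw [integral_add h1 h4, integral_add h2 (h3.const_mul 2),
          integral_const_mul, h, mul_zero, add_zero]

lemma integral_sub_mean_mul_eq_zero {E F : Type*} [MeasurableSpace E] [MeasurableSpace F]
    {μ : Measure E} {ν : Measure F} [IsProbabilityMeasure μ] [SFinite ν]
    {W : Ω → E} {ξ : Ω → F} (hW : Measurable W) (hξ : Measurable ξ)
    (hlaw : P.map (fun ω => (W ω, ξ ω)) = μ.prod ν)
    {f : E × F → ℝ} (hf : Measurable f) (hfint : ∀ x, Integrable (fun w => f (w, x)) μ)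
    {h : F → ℝ} (hh : Measurable h)
    (hint : Integrable (fun ω => (f (W ω, ξ ω) - ∫ w, f (w, ξ ω) ∂μ) * h (ξ ω)) P) :
    ∫ ω, (f (W ω, ξ ω) - ∫ w, f (w, ξ ω) ∂μ) * h (ξ ω) ∂P = 0 := by
  let K : E × F → ℝ := fun z => (f z - ∫ w, f (w, z.2) ∂μ) * h z.2
  have hK : Measurable K :=
    (hf.sub (hf.stronglyMeasurable.integral_prod_left'.measurable.comp measurable_snd)).mul
      (hh.comp measurable_snd)
  have hpair : Measurable fun ω => (W ω, ξ ω) := hW.prodMk hξ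
  have hKint : Integrable K (μ.prod ν) := by
    rw [← hlaw]
    exact (integrable_map_measure hK.aestronglyMeasurable hpair.aemeasurable).2 hint
  calc ∫ ω, K (W ω, ξ ω) ∂P = ∫ z, K z ∂μ.prod ν := by
        rw [← hlaw, integral_map hpair.aemeasurable hK.aestronglyMeasurable]
    _ = ∫ x, ∫ w, K (w, x) ∂μ ∂ν := integral_prod_symm K hKint
    _ = 0 := by
        simp [K, integral_mul_const, integral_sub (hfint _) (integrable_const _)]

lemma integral_sq_sub_eq_add_integral_sq [IsProbabilityMeasure P] {d : ℕ}
    {a b r c q : ℝ} {φ : (Fin d → ℝ) → ℝ}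
    (hq : 0 < q) (hcont : Continuous φ) (hφ : ∀ y, |φ y| ≤ c * (1 + ∑ i, |y i|) ^ q)
    {W ξ : Ω → Fin d → ℝ} (hW : Measurable W) (hξ : Measurable ξ)
    (hWlaw : P.map W = stdGaussian d) (hξval : ∀ ω, ξ ω ∈ cube d a b)
    (hindep : IndepFun W ξ P) {v : (Fin d → ℝ) → ℝ} (hv : ContinuousOn v (cube d a b)) :
    ∫ ω, |φ (r • W ω + ξ ω) - v (ξ ω)| ^ 2 ∂P =
      ∫ ω, |φ (r • W ω + ξ ω) - ∫ w, φ (r • w + ξ ω) ∂stdGaussian d| ^ 2 ∂P +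
        ∫ ω, ((∫ w, φ (r • w + ξ ω) ∂stdGaussian d) - v (ξ ω)) ^ 2 ∂P := by
  obtain ⟨R, hR, hsum⟩ := exists_sum_abs_le_of_mem_cube d a b
  have hX : MemLp (fun ω => φ (r • W ω + ξ ω)) 2 P := by
    refine ((memLp_polynomial_stdGaussian d (c := c) (r := r) hR hq).comp_measurePreserving
      ⟨hW, hWlaw⟩).mono' (hcont.measurable.comp (by fun_prop)).aestronglyMeasurable ?_
    exact Filter.Eventually.of_forall fun ω =>
      abs_shift_le_of_growth hq.le hφ r (W ω) (ξ ω) (hsum _ (hξval ω))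
  have hgcont := continuousOn_integral_shift_stdGaussian hq hcont hφ r a b
  have hG := memLp_comp_of_continuousOn_cube (P := P) hξ hξval hgcont
  have hV := memLp_comp_of_continuousOn_cube (P := P) hξ hξval hv
  refine integral_sq_sub_of_integral_mul_eq_zero hX hG hV ?_
  classical
  let h : (Fin d → ℝ) → ℝ := (cube d a b).piecewise
    (fun x => (∫ w, φ (r • w + x) ∂_root_.stdGaussian d) - v x) 0
  have hh : Measurable h :=
    (hgcont.sub hv).measurable_piecewise continuousOn_const (measurableSet_cube d a b)
  have hhξ (ω : Ω) : h (ξ ω) = (∫ w, φ (r • w + ξ ω) ∂_root_.stdGaussian d) - v (ξ ω) :=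
    Set.piecewise_eq_of_mem _ _ _ (hξval ω)
  simp only [← hhξ]
  have : IsProbabilityMeasure (P.map ξ) := Measure.isProbabilityMeasure_map hξ.aemeasurable
  refine integral_sub_mean_mul_eq_zero (f := fun z => φ (r • z.1 + z.2)) hW hξ
    (ν := P.map ξ) ?_ (hcont.comp (by fun_prop)).measurable
    (integrable_shift_stdGaussian hq hcont hφ r) hh ?_
  · rw [hindep.map_prod_eq_prod_map_map hW.aemeasurable hξ.aemeasurable, hWlaw]
  · simp only [hhξ]
    exact (hX.sub hG).integrable_mul (hG.sub hV)

lemma eqOn_cube_of_integral_sq_sub_eq_zero [IsFiniteMeasure P] {d : ℕ} {a b : ℝ}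
    (hab : a < b)
    {ξ : Ω → Fin d → ℝ} (hξ : Measurable ξ) (hξval : ∀ ω, ξ ω ∈ cube d a b)
    (hξlaw : P.map ξ = uniformCube d a b) {g v : (Fin d → ℝ) → ℝ}
    (hg : ContinuousOn g (cube d a b)) (hv : ContinuousOn v (cube d a b))
    (h : ∫ ω, (g (ξ ω) - v (ξ ω)) ^ 2 ∂P = 0) : EqOn v g (cube d a b) := by
  have hint : Integrable (fun ω => (g (ξ ω) - v (ξ ω)) ^ 2) P :=
    ((memLp_comp_of_continuousOn_cube hξ hξval hg).sub
      (memLp_comp_of_continuousOn_cube hξ hξval hv)).integrable_sq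
  have hzero := (integral_eq_zero_iff_of_nonneg (fun ω => sq_nonneg _) hint).1 h
  have hset : MeasurableSet {x | x ∈ cube d a b → v x = g x} := by
    classical
    have hmeas : Measurable ((cube d a b).piecewise (fun x => v x - g x) 0) :=
      (hv.sub hg).measurable_piecewise continuousOn_const (measurableSet_cube d a b)
    convert hmeas (measurableSet_singleton 0) using 1
    ext x
    by_cases hx : x ∈ cube d a b <;> simp [hx, sub_eq_zero]
  have hae : ∀ᵐ x ∂P.map ξ, x ∈ cube d a b → v x = g x := by
    rw [ae_map_iff hξ.aemeasurable hset]
    filter_upwards [hzero] with ω hω _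
    exact (sub_eq_zero.1 (pow_eq_zero_iff two_ne_zero |>.1 hω)).symm
  rw [hξlaw] at hae
  refine Measure.eqOn_of_ae_eq (μ := volume) ?_ hv hg (closure_interior_cube d hab).ge
  filter_upwards [ae_restrict_of_ae_uniformCube hae, ae_restrict_mem (measurableSet_cube d a b)]
    with x hx hmem using hx hmem

end Probability

/-- **Reformulation of the heat equation as an infinite dimensional stochastic
optimization problem: existence and uniqueness of the minimizer.** -/
theorem heat_min_exists_unique
    (d : ℕ) (hd : 0 < d) (T ρ ϱ : ℝ) (hT : 0 < T) (hρ : 0 < ρ)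
    (hϱ : ϱ = Real.sqrt (2 * ρ * T))
    (a b : ℝ) (hab : a < b)
    (φ : (Fin d → ℝ) → ℝ) (u : ℝ → (Fin d → ℝ) → ℝ)
    (hu : IsC12On d 0 T u) (hgrowth : HasPolyGrowthDerivs d T u)
    (hinit : ∀ x, u 0 x = φ x)
    (hpde : ∀ t ∈ Icc (0:ℝ) T, ∀ x,
      derivWithin (fun s => u s x) (Icc (0:ℝ) T) t = ρ * laplacian d (u t) x)
    {Ω : Type*} [MeasurableSpace Ω] (P : Measure Ω) [IsProbabilityMeasure P]
    (W ξ : Ω → (Fin d → ℝ)) (hW : Measurable W) (hξ : Measurable ξ)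
    (hWlaw : Measure.map W P = stdGaussian d)
    (hξval : ∀ ω, ξ ω ∈ cube d a b)
    (hξlaw : Measure.map ξ P = uniformCube d a b)
    (hindep : IndepFun W ξ P) :
    ∃ U : (Fin d → ℝ) → ℝ,
      (ContinuousOn U (cube d a b) ∧
        (∫ ω, |φ (ϱ • W ω + ξ ω) - U (ξ ω)| ^ 2 ∂P) =
          ⨅ v : {v : (Fin d → ℝ) → ℝ // ContinuousOn v (cube d a b)},
            ∫ ω, |φ (ϱ • W ω + ξ ω) - v.1 (ξ ω)| ^ 2 ∂P) ∧
      ∀ U' : (Fin d → ℝ) → ℝ,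
        (ContinuousOn U' (cube d a b) ∧
          (∫ ω, |φ (ϱ • W ω + ξ ω) - U' (ξ ω)| ^ 2 ∂P) =
            ⨅ v : {v : (Fin d → ℝ) → ℝ // ContinuousOn v (cube d a b)},
              ∫ ω, |φ (ϱ • W ω + ξ ω) - v.1 (ξ ω)| ^ 2 ∂P) →
        Set.EqOn U' U (cube d a b) := by
  obtain ⟨c, q, hq, hbound⟩ := hgrowth
  have hq0 : 0 < q := one_pos.trans_le hq
  have h0 : (0 : ℝ) ∈ Icc 0 T := ⟨le_rfl, hT.le⟩
  obtain rfl : u 0 = φ := funext hinit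
  have hcont : Continuous (u 0) := (hu.2.2.2.1 0 h0).continuous
  have hφ (y) : |u 0 y| ≤ c * (1 + ∑ i, |y i|) ^ q := (hbound 0 h0 y).1
  set g : (Fin d → ℝ) → ℝ := fun x => ∫ w, u 0 (ϱ • w + x) ∂stdGaussian d
  have hgcont : ContinuousOn g (cube d a b) :=
    continuousOn_integral_shift_stdGaussian hq0 hcont hφ ϱ a b
  have hdecomp (v) (hv : ContinuousOn v (cube d a b)) :
      ∫ ω, |u 0 (ϱ • W ω + ξ ω) - v (ξ ω)| ^ 2 ∂P =
        ∫ ω, |u 0 (ϱ • W ω + ξ ω) - g (ξ ω)| ^ 2 ∂P + ∫ ω, (g (ξ ω) - v (ξ ω)) ^ 2 ∂P :=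
    integral_sq_sub_eq_add_integral_sq hq0 hcont hφ hW hξ hWlaw hξval hindep hv
  have hle (v) (hv : ContinuousOn v (cube d a b)) :
      ∫ ω, |u 0 (ϱ • W ω + ξ ω) - g (ξ ω)| ^ 2 ∂P ≤
        ∫ ω, |u 0 (ϱ • W ω + ξ ω) - v (ξ ω)| ^ 2 ∂P := by
    rw [hdecomp v hv]
    exact le_add_of_nonneg_right (integral_nonneg fun ω => sq_nonneg _)
  have hinf : ∫ ω, |u 0 (ϱ • W ω + ξ ω) - g (ξ ω)| ^ 2 ∂P =
      ⨅ v : {v : (Fin d → ℝ) → ℝ // ContinuousOn v (cube d a b)},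
        ∫ ω, |u 0 (ϱ • W ω + ξ ω) - v.1 (ξ ω)| ^ 2 ∂P := by
    have : Nonempty {v : (Fin d → ℝ) → ℝ // ContinuousOn v (cube d a b)} := ⟨⟨g, hgcont⟩⟩
    refine le_antisymm (le_ciInf fun v => hle v.1 v.2) ?_
    exact ciInf_le (f := fun v : {v : (Fin d → ℝ) → ℝ // ContinuousOn v (cube d a b)} =>
      ∫ ω, |u 0 (ϱ • W ω + ξ ω) - v.1 (ξ ω)| ^ 2 ∂P)
      ⟨_, Set.forall_mem_range.2 fun v => hle v.1 v.2⟩ ⟨g, hgcont⟩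
  refine ⟨g, ⟨hgcont, hinf⟩, fun v ⟨hv, hvinf⟩ => ?_⟩
  refine eqOn_cube_of_integral_sq_sub_eq_zero hab hξ hξval hξlaw hgcont hv ?_
  linarith [hdecomp v hv]

end
end

section
/- (Feynman–Kac formula for the heat equation.) Let d ∈ ℕ, let T, ρ ∈ (0,∞), let φ: ℝ^d → ℝ be a function, and let u ∈ C^{1,2}([0,T]×ℝ^d, ℝ) be a function with at most polynomially growing partial derivatives which satisfies for every t ∈ [0,T], x ∈ ℝ^d that u(0,x) = φ(x) and ∂u/∂t(t,x) = ρ Δ_x u(t,x). Then for every t ∈ [0,T] and every x ∈ ℝ^d it holds that u(t,x) = ∫_{ℝ^d} φ(x + √(2ρt) w) γ_d(dw), where γ_d denotes the standard Gaussian measure on ℝ^d; in particular, u(T,x) = E[φ(x + √(2ρT) 𝕎)] for a standard normal random vector 𝕎 on ℝ^d. -/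
open MeasureTheory ProbabilityTheory Set

noncomputable section

theorem integrable_exp_mul_abs_gaussianReal (K : ℝ) :
    Integrable (fun x : ℝ => Real.exp (K * |x|)) (gaussianReal 0 1) := by
  refine ((integrable_exp_mul_gaussianReal K).add (integrable_exp_mul_gaussianReal (-K))).mono'
    (by fun_prop) (Filter.Eventually.of_forall fun x => ?_)
  rw [Real.norm_eq_abs, Real.abs_exp, Pi.add_apply]
  rcases abs_cases x with ⟨h, -⟩ | ⟨h, -⟩ <;> rw [h]
  · linarith [Real.exp_pos (-K * x)]
  · rw [mul_neg, ← neg_mul]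
    linarith [Real.exp_pos (K * x)]

theorem integrable_exp_sum_abs_stdGaussian (d : ℕ) (K : ℝ) :
    Integrable (fun w : Fin d → ℝ => Real.exp (K * ∑ i, |w i|)) (stdGaussian d) := by
  simp_rw [Finset.mul_sum, Real.exp_sum]
  exact Integrable.fintype_prod (f := fun _ x => Real.exp (K * |x|))
    fun _ => integrable_exp_mul_abs_gaussianReal K

theorem integrable_stdGaussian_of_exp_bound {d : ℕ} {g : (Fin d → ℝ) → ℝ} {C K : ℝ}
    (hg : Measurable g) (hb : ∀ w, |g w| ≤ C * Real.exp (K * ∑ i, |w i|)) :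
    Integrable g (stdGaussian d) :=
  ((integrable_exp_sum_abs_stdGaussian d K).const_mul C).mono' hg.aestronglyMeasurable
    (Filter.Eventually.of_forall hb)

/-- The density of the standard Gaussian measure on `ℝ^d`. -/
def stdGaussianPDF (d : ℕ) (w : Fin d → ℝ) : ℝ := ∏ i, gaussianPDFReal 0 1 (w i)

theorem stdGaussianPDF_nonneg (d : ℕ) (w : Fin d → ℝ) : 0 ≤ stdGaussianPDF d w :=
  Finset.prod_nonneg fun _ _ => gaussianPDFReal_nonneg _ _ _

theorem measurable_stdGaussianPDF (d : ℕ) : Measurable (stdGaussianPDF d) := by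
  unfold stdGaussianPDF
  fun_prop

theorem stdGaussian_eq_withDensity (d : ℕ) :
    stdGaussian d = volume.withDensity fun w => ENNReal.ofReal (stdGaussianPDF d w) := by
  refine Measure.pi_eq fun s hs => ?_
  have hint : Integrable (stdGaussianPDF d) (Measure.pi fun i => volume.restrict (s i)) :=
    Integrable.fintype_prod fun i => (integrable_gaussianPDFReal 0 1).restrict
  rw [withDensity_apply _ (MeasurableSet.univ_pi hs), volume_pi, Measure.restrict_pi_pi,
    ← ofReal_integral_eq_lintegral_ofReal hint
      (Filter.Eventually.of_forall (stdGaussianPDF_nonneg d))]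
  unfold stdGaussianPDF
  rw [integral_fintype_prod_eq_prod (fun _ x => gaussianPDFReal 0 1 x),
    ENNReal.ofReal_prod_of_nonneg fun i _ => integral_nonneg (gaussianPDFReal_nonneg _ _)]
  exact Finset.prod_congr rfl fun i _ => (gaussianReal_apply_eq_integral _ one_ne_zero _).symm

theorem integral_stdGaussian_eq {d : ℕ} (g : (Fin d → ℝ) → ℝ) :
    ∫ w, g w ∂(stdGaussian d) = ∫ w, stdGaussianPDF d w * g w := by
  rw [stdGaussian_eq_withDensity, integral_withDensity_eq_integral_toReal_smul
    (measurable_stdGaussianPDF d).ennreal_ofReal (by simp)]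
  simp [ENNReal.toReal_ofReal (stdGaussianPDF_nonneg d _)]

theorem integrable_stdGaussian_iff {d : ℕ} (g : (Fin d → ℝ) → ℝ) :
    Integrable g (stdGaussian d) ↔ Integrable fun w => stdGaussianPDF d w * g w := by
  rw [stdGaussian_eq_withDensity, integrable_withDensity_iff_integrable_smul'
    (measurable_stdGaussianPDF d).ennreal_ofReal (by simp)]
  simp [ENNReal.toReal_ofReal (stdGaussianPDF_nonneg d _)]

theorem hasFDerivAt_stdGaussianPDF (d : ℕ) (w : Fin d → ℝ) :
    HasFDerivAt (stdGaussianPDF d)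
      (stdGaussianPDF d w • -∑ i, w i • ContinuousLinearMap.proj (R := ℝ) i) w := by
  have hpdf : stdGaussianPDF d =
      fun w => (√(2 * Real.pi))⁻¹ ^ d * Real.exp (-(∑ i, w i ^ 2) / 2) := by
    ext w
    simp [stdGaussianPDF, gaussianPDFReal, Finset.prod_mul_distrib, ← Real.exp_sum,
      ← Finset.sum_div, neg_div]
  have hsum : HasFDerivAt (fun w : Fin d → ℝ => -(∑ i, w i ^ 2) / 2)
      (-∑ i, w i • ContinuousLinearMap.proj (R := ℝ) i) w := by
    have h := (HasFDerivAt.fun_sum (u := Finset.univ) fun i _ =>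
      (hasFDerivAt_apply (𝕜 := ℝ) i w).pow 2).neg.mul_const (2⁻¹ : ℝ)
    refine h.congr_fderiv ?_
    ext v
    simp [Finset.mul_sum, ← mul_assoc]
  rw [hpdf]
  refine (hsum.exp.const_mul _).congr_fderiv ?_
  rw [smul_smul]

/-- Gaussian integration by parts (Stein's identity). -/
theorem integral_mul_stdGaussian_eq_integral_fderiv {d : ℕ} {g : (Fin d → ℝ) → ℝ} {C K : ℝ}
    (i : Fin d) (hg : Differentiable ℝ g)
    (hb : ∀ w, |g w| ≤ C * Real.exp (K * ∑ j, |w j|))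
    (hb' : ∀ w, |fderiv ℝ g w (Pi.single i 1)| ≤ C * Real.exp (K * ∑ j, |w j|)) :
    Integrable (fun w => w i * g w) (stdGaussian d) ∧
    ∫ w, w i * g w ∂(stdGaussian d) = ∫ w, fderiv ℝ g w (Pi.single i 1) ∂(stdGaussian d) := by
  have hwg : Integrable (fun w => w i * g w) (stdGaussian d) := by
    refine integrable_stdGaussian_of_exp_bound (C := C) (K := K + 1)
      ((measurable_pi_apply i).mul hg.continuous.measurable) fun w => ?_
    have hi : |w i| ≤ Real.exp (∑ j, |w j|) :=
      (Finset.single_le_sum (fun j _ => abs_nonneg (w j)) (Finset.mem_univ i)).trans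
        ((lt_add_one _).le.trans (Real.add_one_le_exp _))
    calc |w i * g w| = |w i| * |g w| := abs_mul _ _
      _ ≤ Real.exp (∑ j, |w j|) * (C * Real.exp (K * ∑ j, |w j|)) := by gcongr; exact hb w
      _ = C * Real.exp ((K + 1) * ∑ j, |w j|) := by rw [add_mul, Real.exp_add, one_mul]; ring
  have hfd : ∀ w, fderiv ℝ (stdGaussianPDF d) w (Pi.single i 1) = -(stdGaussianPDF d w * w i) := by
    intro w
    rw [(hasFDerivAt_stdGaussianPDF d w).fderiv]
    simp [Pi.single_apply]
  refine ⟨hwg, ?_⟩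
  have h := integral_mul_fderiv_eq_neg_fderiv_mul_of_integrable (μ := volume)
    (f := stdGaussianPDF d) (g := g) (v := Pi.single i 1) ?_ ?_ ?_
    (fun w _ => (hasFDerivAt_stdGaussianPDF d w).differentiableAt) (fun w _ => hg w)
  · rw [integral_stdGaussian_eq, integral_stdGaussian_eq, h, ← integral_neg]
    refine integral_congr_ae (Filter.Eventually.of_forall fun w => ?_)
    simp only [hfd]
    ring
  · refine ((integrable_stdGaussian_iff _).1 hwg).neg.congr
      (Filter.Eventually.of_forall fun w => ?_)
    simp only [hfd, Pi.neg_apply]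
    ring
  · exact (integrable_stdGaussian_iff _).1
      (integrable_stdGaussian_of_exp_bound (measurable_fderiv_apply_const ℝ g _) hb')
  · exact (integrable_stdGaussian_iff _).1
      (integrable_stdGaussian_of_exp_bound hg.continuous.measurable hb)

theorem HasPolyGrowthDerivs.exists_exp_bound {d : ℕ} {T : ℝ} {u : ℝ → (Fin d → ℝ) → ℝ}
    (h : HasPolyGrowthDerivs d T u) :
    ∃ C K : ℝ, 0 ≤ C ∧ 0 ≤ K ∧ ∀ t ∈ Icc (0:ℝ) T, ∀ x : Fin d → ℝ,
      |u t x| ≤ C * Real.exp (K * ∑ i, |x i|) ∧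
      |derivWithin (fun s => u s x) (Icc (0:ℝ) T) t| ≤ C * Real.exp (K * ∑ i, |x i|) ∧
      (∀ i, |spatialPD1 d (u t) i x| ≤ C * Real.exp (K * ∑ i, |x i|)) ∧
      (∀ i j, |spatialPD2 d (u t) i j x| ≤ C * Real.exp (K * ∑ i, |x i|)) := by
  obtain ⟨c, q, hq, h⟩ := h
  refine ⟨|c|, q, abs_nonneg c, by linarith, fun t ht x => ?_⟩
  have hle : c * (1 + ∑ i, |x i|) ^ q ≤ |c| * Real.exp (q * ∑ i, |x i|) := by
    have hS : 0 ≤ ∑ i, |x i| := Finset.sum_nonneg fun i _ => abs_nonneg (x i)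
    refine mul_le_mul (le_abs_self c) ?_ (by positivity) (abs_nonneg c)
    rw [mul_comm q, Real.exp_mul]
    refine Real.rpow_le_rpow (by positivity) ?_ (by linarith)
    linarith [Real.add_one_le_exp (∑ i, |x i|)]
  obtain ⟨h0, h1, h2, h3⟩ := h t ht x
  exact ⟨h0.trans hle, h1.trans hle, fun i => (h2 i).trans hle, fun i j => (h3 i j).trans hle⟩

theorem exp_mul_sum_abs_add_smul_le {d : ℕ} {K a A : ℝ} (hK : 0 ≤ K) (ha : |a| ≤ A)
    (x w : Fin d → ℝ) :
    Real.exp (K * ∑ i, |(x + a • w) i|) ≤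
      Real.exp (K * ∑ i, |x i|) * Real.exp (K * A * ∑ i, |w i|) := by
  rw [← Real.exp_add, mul_assoc, ← mul_add, Finset.mul_sum _ _ A, ← Finset.sum_add_distrib]
  gcongr with i
  simp only [Pi.add_apply, Pi.smul_apply, smul_eq_mul]
  refine (abs_add_le _ _).trans ?_
  rw [abs_mul]
  gcongr

theorem IsC12On.hasFDerivAt {d : ℕ} {T : ℝ} {u : ℝ → (Fin d → ℝ) → ℝ} (hu : IsC12On d 0 T u)
    {t : ℝ} (ht : t ∈ Ioo 0 T) (y : Fin d → ℝ) :
    HasFDerivAt (fun p : ℝ × (Fin d → ℝ) => u p.1 p.2)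
      ((ContinuousLinearMap.toSpanSingleton ℝ
          (derivWithin (fun s => u s y) (Icc (0:ℝ) T) t)).coprod
        (∑ i, spatialPD1 d (u t) i y • ContinuousLinearMap.proj (R := ℝ) i)) (t, y) := by
  obtain ⟨-, hdiff, hct, hC2, hcx, -⟩ := hu
  have hnhds : Icc 0 T ×ˢ (univ : Set (Fin d → ℝ)) ∈ nhds (t, y) :=
    prod_mem_nhds (Icc_mem_nhds ht.1 ht.2) Filter.univ_mem
  have hev : ∀ᶠ v : ℝ × (Fin d → ℝ) in nhds (t, y), v.1 ∈ Ioo 0 T :=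
    continuous_fst.continuousAt.eventually (Ioo_mem_nhds ht.1 ht.2)
  refine (hasStrictFDerivAt_uncurry_coprod (u := (t, y)) (f := u)
    (f₁ := fun s z => ContinuousLinearMap.toSpanSingleton ℝ
      (derivWithin (fun s => u s z) (Icc (0:ℝ) T) s))
    (f₂ := fun s z => ∑ i, spatialPD1 d (u s) i z • ContinuousLinearMap.proj (R := ℝ) i)
    ?_ ?_ ?_ ?_).hasFDerivAt
  · filter_upwards [hev] with v hv
    exact ((hdiff v.2 v.1 (Ioo_subset_Icc_self hv)).hasDerivWithinAt.hasDerivAt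
      (Icc_mem_nhds hv.1 hv.2)).hasFDerivAt
  · filter_upwards [hev] with v hv
    have h := ((hC2 v.1 (Ioo_subset_Icc_self hv)).differentiable (by norm_num) v.2).hasFDerivAt
    refine h.congr_fderiv ?_
    refine (ContinuousLinearMap.coe_inj.1 ((Pi.basisFun ℝ (Fin d)).ext fun j => ?_))
    simp [Function.HasUncurry.uncurry, spatialPD1, Pi.single_apply]
  · exact (ContinuousLinearMap.toSpanSingletonCLE (𝕜 := ℝ) (E := ℝ)).continuous.continuousAt.comp
      (hct.continuousAt hnhds)
  · have hproj : ∀ i, ContinuousAt (fun p : ℝ × (Fin d → ℝ) =>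
        spatialPD1 d (u p.1) i p.2 • ContinuousLinearMap.proj (R := ℝ) (φ := fun _ => ℝ) i)
        (t, y) :=
      fun i => ((hcx i).continuousAt hnhds).smul continuousAt_const
    have hsum : ContinuousAt (fun p : ℝ × (Fin d → ℝ) => ∑ i,
        spatialPD1 d (u p.1) i p.2 • ContinuousLinearMap.proj (R := ℝ) (φ := fun _ => ℝ) i)
        (t, y) := tendsto_finsetSum Finset.univ fun i _ => hproj i
    exact hsum

/-- Derivative of `a ↦ u (t - a² / (2ρ), x + a w)`. -/
theorem IsC12On.hasDerivAt_heatCurve {d : ℕ} {T ρ t a : ℝ} {u : ℝ → (Fin d → ℝ) → ℝ}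
    (hu : IsC12On d 0 T u) (ha : t - a ^ 2 / (2 * ρ) ∈ Ioo 0 T) (x w : Fin d → ℝ) :
    HasDerivAt (fun a => u (t - a ^ 2 / (2 * ρ)) (x + a • w))
      (-(a / ρ) * derivWithin (fun s => u s (x + a • w)) (Icc (0:ℝ) T) (t - a ^ 2 / (2 * ρ)) +
        ∑ i, w i * spatialPD1 d (u (t - a ^ 2 / (2 * ρ))) i (x + a • w)) a := by
  have h1 : HasDerivAt (fun a : ℝ => t - a ^ 2 / (2 * ρ)) (-(a / ρ)) a := by
    refine (((hasDerivAt_pow 2 a).div_const (2 * ρ)).const_sub t).congr_deriv ?_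
    rw [Nat.cast_ofNat, pow_one, mul_div_mul_left _ _ two_ne_zero]
  have h2 : HasDerivAt (fun a : ℝ => x + a • w) w a := by
    simpa using ((hasDerivAt_id a).smul_const w).const_add x
  refine ((hu.hasFDerivAt ha (x + a • w)).comp_hasDerivAt a (h1.prodMk h2)).congr_deriv ?_
  simp [mul_comm]

/-- **Feynman–Kac formula for the heat equation.** -/
theorem feynman_kac_heat
    (d : ℕ) (hd : 0 < d) (T ρ : ℝ) (hT : 0 < T) (hρ : 0 < ρ)
    (φ : (Fin d → ℝ) → ℝ) (u : ℝ → (Fin d → ℝ) → ℝ)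
    (hu : IsC12On d 0 T u) (hgrowth : HasPolyGrowthDerivs d T u)
    (hinit : ∀ x, u 0 x = φ x)
    (hpde : ∀ t ∈ Icc (0:ℝ) T, ∀ x,
      derivWithin (fun s => u s x) (Icc (0:ℝ) T) t = ρ * laplacian d (u t) x) :
    ∀ t ∈ Icc (0:ℝ) T, ∀ x : Fin d → ℝ,
      u t x = ∫ w, φ (x + Real.sqrt (2 * ρ * t) • w) ∂(stdGaussian d) := by
  intro t ht x
  obtain ⟨C, K, hC, hK, hbd⟩ := hgrowth.exists_exp_bound
  have hcont := hu.1
  have hC2 := hu.2.2.2.1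
  rcases ht.1.eq_or_lt with rfl | ht0
  · simp [hinit, _root_.stdGaussian]
  set A := √(2 * ρ * t) with hA
  have hApos : 0 < A := Real.sqrt_pos.2 (by positivity)
  have hAsq : A ^ 2 = 2 * ρ * t := Real.sq_sqrt (by positivity)
  set C' := C * Real.exp (K * ∑ i, |x i|) with hC'
  have hC'0 : 0 ≤ C' := by positivity
  have htime : ∀ a ∈ Icc 0 A, t - a ^ 2 / (2 * ρ) ∈ Icc 0 T := by
    intro a ha
    have h1 : a ^ 2 ≤ 2 * ρ * t := hAsq ▸ pow_le_pow_left₀ ha.1 ha.2 2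
    have h2 : a ^ 2 / (2 * ρ) ≤ t := by rw [div_le_iff₀ (by positivity)]; linarith
    have h3 : 0 ≤ a ^ 2 / (2 * ρ) := by positivity
    exact ⟨by linarith, by linarith [ht.2]⟩
  have htime' : ∀ a ∈ Ioo 0 A, t - a ^ 2 / (2 * ρ) ∈ Ioo 0 T := by
    intro a ha
    have h1 : a ^ 2 < 2 * ρ * t := hAsq ▸ pow_lt_pow_left₀ ha.2 ha.1.le two_ne_zero
    have h2 : a ^ 2 / (2 * ρ) < t := by rw [div_lt_iff₀ (by positivity)]; linarith
    have h3 : 0 < a ^ 2 / (2 * ρ) := by have := ha.1; positivity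
    exact ⟨by linarith, by linarith [ht.2]⟩
  have hexp : ∀ a ∈ Icc 0 A, ∀ w : Fin d → ℝ, C * Real.exp (K * ∑ i, |(x + a • w) i|) ≤
      C' * Real.exp (K * A * ∑ i, |w i|) := by
    intro a ha w
    rw [hC', mul_assoc]
    gcongr
    exact exp_mul_sum_abs_add_smul_le hK (by rw [abs_of_nonneg ha.1]; exact ha.2) x w
  set F : ℝ → (Fin d → ℝ) → ℝ := fun a w => u (t - a ^ 2 / (2 * ρ)) (x + a • w) with hF
  set D : ℝ → (Fin d → ℝ) → ℝ := fun a w =>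
    derivWithin (fun s => u s (x + a • w)) (Icc (0:ℝ) T) (t - a ^ 2 / (2 * ρ)) with hD
  set G : ℝ → Fin d → (Fin d → ℝ) → ℝ := fun a i w =>
    spatialPD1 d (u (t - a ^ 2 / (2 * ρ))) i (x + a • w) with hG
  have hFb : ∀ a ∈ Icc 0 A, ∀ w, |F a w| ≤ C' * Real.exp (K * A * ∑ i, |w i|) :=
    fun a ha w => (hbd _ (htime a ha) _).1.trans (hexp a ha w)
  have hDb : ∀ a ∈ Icc 0 A, ∀ w, |D a w| ≤ C' * Real.exp (K * A * ∑ i, |w i|) :=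
    fun a ha w => (hbd _ (htime a ha) _).2.1.trans (hexp a ha w)
  have hGb : ∀ a ∈ Icc 0 A, ∀ i w, |G a i w| ≤ C' * Real.exp (K * A * ∑ i, |w i|) :=
    fun a ha i w => ((hbd _ (htime a ha) _).2.2.1 i).trans (hexp a ha w)
  have hFm : ∀ a ∈ Icc 0 A, Measurable (F a) := fun a ha =>
    ((hC2 _ (htime a ha)).continuous.comp (by fun_prop)).measurable
  have hDm : ∀ a ∈ Icc 0 A, Measurable (D a) := by
    intro a ha
    refine Continuous.measurable ?_
    exact hu.2.2.1.comp_continuous (f := fun w => (t - a ^ 2 / (2 * ρ), x + a • w)) (by fun_prop)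
      fun w => ⟨htime a ha, mem_univ _⟩
  have hGm : ∀ a ∈ Icc 0 A, ∀ i, Measurable (G a i) := by
    intro a ha i
    refine Continuous.measurable ?_
    exact (hu.2.2.2.2.1 i).comp_continuous (f := fun w => (t - a ^ 2 / (2 * ρ), x + a • w))
      (by fun_prop) fun w => ⟨htime a ha, mem_univ _⟩
  have hFderiv : ∀ a ∈ Ioo 0 A, ∀ w,
      HasDerivAt (F · w) (-(a / ρ) * D a w + ∑ i, w i * G a i w) a :=
    fun a ha w => hu.hasDerivAt_heatCurve (htime' a ha) x w
  have hcontF : ContinuousOn (fun a => ∫ w, F a w ∂(stdGaussian d)) (Icc 0 A) := by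
    refine continuousOn_of_dominated (fun a ha => (hFm a ha).aestronglyMeasurable)
      (fun a ha => Filter.Eventually.of_forall (hFb a ha))
      ((integrable_exp_sum_abs_stdGaussian d (K * A)).const_mul C')
      (Filter.Eventually.of_forall fun w => ?_)
    exact hcont.comp (f := fun a : ℝ => (t - a ^ 2 / (2 * ρ), x + a • w)) (by fun_prop)
      fun a ha => ⟨htime a ha, mem_univ _⟩
  have hzero : ∀ a ∈ Ioo 0 A,
      ∫ w, (-(a / ρ) * D a w + ∑ i, w i * G a i w) ∂(stdGaussian d) = 0 := by
    intro a ha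
    have ha' := Ioo_subset_Icc_self ha
    set v := u (t - a ^ 2 / (2 * ρ)) with hv
    set H : Fin d → (Fin d → ℝ) → ℝ := fun i w => spatialPD2 d v i i (x + a • w) with hH
    have hHb : ∀ i w, |H i w| ≤ C' * Real.exp (K * A * ∑ i, |w i|) :=
      fun i w => ((hbd _ (htime a ha') _).2.2.2 i i).trans (hexp a ha' w)
    have hGd : ∀ i w, HasFDerivAt (G a i)
        (a • fderiv ℝ (fun y => fderiv ℝ v y (Pi.single i 1)) (x + a • w)) w := by
      intro i w
      have h1 : HasFDerivAt (fun w : Fin d → ℝ => x + a • w)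
          (a • ContinuousLinearMap.id ℝ (Fin d → ℝ)) w :=
        ((hasFDerivAt_id w).const_smul a).const_add x
      have h2 : Differentiable ℝ (fun y => fderiv ℝ v y (Pi.single i 1)) :=
        (((hC2 _ (htime a ha')).fderiv_right (m := 1) (by norm_num)).differentiable
          one_ne_zero).clm_apply (differentiable_const _)
      refine ((h2 (x + a • w)).hasFDerivAt.comp w h1).congr_fderiv ?_
      ext z
      simp
    have hGd' : ∀ i w, fderiv ℝ (G a i) w (Pi.single i 1) = a * H i w := by
      intro i w
      rw [(hGd i w).fderiv]
      rfl
    have hHm : ∀ i, Measurable (H i) := by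
      intro i
      refine Continuous.measurable ?_
      exact (hu.2.2.2.2.2 i i).comp_continuous (f := fun w => (t - a ^ 2 / (2 * ρ), x + a • w))
        (by fun_prop) fun w => ⟨htime a ha', mem_univ _⟩
    have hHi : ∀ i, Integrable (H i) (stdGaussian d) := fun i =>
      integrable_stdGaussian_of_exp_bound (hHm i) (hHb i)
    have hstein : ∀ i, Integrable (fun w => w i * G a i w) (stdGaussian d) ∧
        ∫ w, w i * G a i w ∂(stdGaussian d) = a * ∫ w, H i w ∂(stdGaussian d) := by
      intro i
      have h := integral_mul_stdGaussian_eq_integral_fderiv (C := (1 + a) * C') (K := K * A) i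
        (fun w => (hGd i w).differentiableAt) (fun w => (hGb a ha' i w).trans ?_) fun w => ?_
      · simpa only [hGd', integral_const_mul] using h
      · gcongr
        nlinarith [ha.1]
      · rw [hGd', abs_mul, abs_of_pos ha.1, mul_assoc]
        exact mul_le_mul (by linarith) (hHb i w) (abs_nonneg _) (by linarith [ha.1])
    have hDH : ∀ w, D a w = ρ * ∑ i, H i w := fun w => hpde _ (htime a ha') _
    rw [integral_add ((integrable_stdGaussian_of_exp_bound (hDm a ha') (hDb a ha')).const_mul _)
      (integrable_finsetSum _ fun i _ => (hstein i).1),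
      integral_const_mul, integral_finsetSum _ fun i _ => (hstein i).1]
    simp_rw [hDH, fun i => (hstein i).2]
    rw [integral_const_mul, integral_finsetSum _ fun i _ => hHi i, ← Finset.mul_sum]
    field_simp
    ring
  have hderiv : ∀ a ∈ Ioo 0 A, HasDerivAt (fun a => ∫ w, F a w ∂(stdGaussian d)) 0 a := by
    intro a ha
    have ha' := Ioo_subset_Icc_self ha
    rw [← hzero a ha]
    refine (hasDerivAt_integral_of_dominated_loc_of_deriv_le
      (F' := fun a w => -(a / ρ) * D a w + ∑ i, w i * G a i w)
      (bound := fun w => (A / ρ + 1) * C' * Real.exp ((K * A + 1) * ∑ i, |w i|))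
      (Ioo_mem_nhds ha.1 ha.2) ?_ ?_ ?_ ?_ ?_ ?_).2
    · filter_upwards [Ioo_mem_nhds ha.1 ha.2] with b hb
      exact (hFm b (Ioo_subset_Icc_self hb)).aestronglyMeasurable
    · exact integrable_stdGaussian_of_exp_bound (hFm a ha') (hFb a ha')
    · exact (((hDm a ha').const_mul _).add (Finset.measurable_fun_sum _ fun i _ =>
        (measurable_pi_apply i).mul (hGm a ha' i))).aestronglyMeasurable
    · refine Filter.Eventually.of_forall fun w b hb => ?_
      have hb' := Ioo_subset_Icc_self hb
      set S := ∑ i, |w i| with hS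
      set B := C' * Real.exp (K * A * S) with hB
      have hB0 : 0 ≤ B := by positivity
      have hS0 : 0 ≤ S := Finset.sum_nonneg fun i _ => abs_nonneg _
      have hSexp : S + 1 ≤ Real.exp S := Real.add_one_le_exp S
      have h1 : |-(b / ρ) * D b w| ≤ A / ρ * B := by
        rw [abs_mul, abs_neg, abs_of_nonneg (div_nonneg hb'.1 hρ.le)]
        have := hb'.2
        exact mul_le_mul (by gcongr) (hDb b hb' w) (abs_nonneg _) (by positivity)
      have h2 : |∑ i, w i * G b i w| ≤ S * B := by
        rw [hS, Finset.sum_mul]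
        refine (Finset.abs_sum_le_sum_abs _ _).trans (Finset.sum_le_sum fun i _ => ?_)
        rw [abs_mul]
        gcongr
        exact hGb b hb' i w
      have hAρ : 0 ≤ A / ρ := by positivity
      calc ‖-(b / ρ) * D b w + ∑ i, w i * G b i w‖ ≤ A / ρ * B + S * B :=
            (abs_add_le _ _).trans (add_le_add h1 h2)
        _ = (A / ρ + S) * B := by ring
        _ ≤ ((A / ρ + 1) * Real.exp S) * B := by
          gcongr
          nlinarith
        _ = (A / ρ + 1) * C' * Real.exp ((K * A + 1) * S) := by
          rw [hB, add_mul (K * A), Real.exp_add, one_mul]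
          ring
    · exact (integrable_exp_sum_abs_stdGaussian d (K * A + 1)).const_mul _
    · exact Filter.Eventually.of_forall fun w b hb => hFderiv b hb w
  obtain ⟨a, ha, hslope⟩ := exists_hasDerivAt_eq_slope _ (fun _ => 0) hApos hcontF hderiv
  have hconst : ∫ w, F A w ∂(stdGaussian d) = ∫ w, F 0 w ∂(stdGaussian d) := by
    rw [eq_comm, div_eq_zero_iff, sub_eq_zero] at hslope
    exact hslope.resolve_right (by linarith)
  have hFA : ∀ w, F A w = φ (x + A • w) := by
    intro w
    have : t - A ^ 2 / (2 * ρ) = 0 := by rw [hAsq]; field_simp; ring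
    simp only [hF, this, hinit]
  have hF0 : ∀ w, F 0 w = u t x := by
    intro w
    simp [hF]
  simp_rw [← hFA, hconst, hF0]
  simp [_root_.stdGaussian]

end
end

section
/- Let T ∈ (0,∞), p ∈ [1,∞), let f ∈ C²(ℝ,ℝ), and for every d ∈ ℕ let u_d ∈ C^{1,2}([0,T]×ℝ^d,ℝ) satisfy for all t ∈ [0,T], x ∈ ℝ^d that ∂u_d/∂t(t,x) = Δ_x u_d(t,x) + f(u_d(t,x)). Assume that f′ is bounded, and assume for every d ∈ ℕ and all i,j ∈ {1,…,d} that sup over t ∈ [0,T] and x = (x_1,…,x_d) ∈ ℝ^d of (1 + Σ_{k=1}^d |x_k|)^{−p} ( |u_d(t,x)| + |∂u_d/∂x_i(t,x)| + |∂²u_d/(∂x_i∂x_j)(t,x)| + |∂u_d/∂t(t,x)| + |f″(x_1)| ) is finite. Then for all d, N ∈ ℕ there exist unique functions 𝒰^{d,N}_n ∈ C^{1,2}([(n−1)T/N, nT/N]×ℝ^d, ℝ) for n ∈ {0,1,…,N}, each growing at most polynomially (i.e. for each d, N, n there exist c ∈ ℝ, q ∈ [1,∞) with |𝒰^{d,N}_n(t,x)|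 ≤ c(1+Σ_{k=1}^d|x_k|)^q), which satisfy for all n ∈ {0,1,…,N−1}, t ∈ [nT/N,(n+1)T/N], s ∈ [−T/N, 0], x ∈ ℝ^d that 𝒰^{d,N}_{n+1}(nT/N, x) = 𝒰^{d,N}_n(nT/N, x) + (T/N)·f(𝒰^{d,N}_n(nT/N, x)), 𝒰^{d,N}_0(s,x) = u_d(0,x), and ∂𝒰^{d,N}_{n+1}/∂t(t,x) = Δ_x 𝒰^{d,N}_{n+1}(t,x). -/
open MeasureTheory ProbabilityTheory Set

noncomputable section

/-- `U : {0,1,…,N} → (time → space → ℝ)` is a family of solutions of the splitting-up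
scheme for the semilinear heat equation `∂u/∂t = Δu + f(u)` with initial value `u0`:
each `U n` is a `C^{1,2}` function on `[(n−1)T/N, nT/N] × ℝ^d` growing at most
polynomially, `U 0` is constantly (in time) equal to `u0`, each `U (n+1)` solves the
linear heat equation on `[nT/N, (n+1)T/N]`, and at the grid points the nonlinearity is
incorporated by an explicit Euler step. -/
def SplittingSol (T : ℝ) (f : ℝ → ℝ) (d N : ℕ) (u0 : (Fin d → ℝ) → ℝ)
    (U : ℕ → ℝ → (Fin d → ℝ) → ℝ) : Prop :=
  (∀ n ≤ N, IsC12On d (((n : ℝ) - 1) * T / N) ((n : ℝ) * T / N) (U n)) ∧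
  (∀ n ≤ N, ∃ c q : ℝ, 1 ≤ q ∧
    ∀ t ∈ Icc (((n : ℝ) - 1) * T / N) ((n : ℝ) * T / N), ∀ x : Fin d → ℝ,
      |U n t x| ≤ c * (1 + ∑ i, |x i|) ^ q) ∧
  (∀ n < N, ∀ x : Fin d → ℝ,
    U (n + 1) ((n : ℝ) * T / N) x
      = U n ((n : ℝ) * T / N) x + (T / N) * f (U n ((n : ℝ) * T / N) x)) ∧
  (∀ s ∈ Icc (-(T / (N : ℝ))) 0, ∀ x : Fin d → ℝ, U 0 s x = u0 x) ∧
  (∀ n < N, ∀ t ∈ Icc ((n : ℝ) * T / N) (((n : ℝ) + 1) * T / N), ∀ x : Fin d → ℝ,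
    derivWithin (fun s => U (n + 1) s x) (Icc ((n : ℝ) * T / N) (((n : ℝ) + 1) * T / N)) t
      = laplacian d (U (n + 1) t) x)

section MaximumPrinciple

open Filter Topology

lemma deriv_deriv_nonpos_of_isLocalMax {φ : ℝ → ℝ} {x : ℝ} (h : IsLocalMax φ x)
    (hc : ContinuousAt φ x) : deriv (deriv φ) x ≤ 0 := by
  by_contra! hpos
  have hmin : IsLocalMin φ x := isLocalMin_of_deriv_deriv_pos hpos h.deriv_eq_zero hc
  have hconst : φ =ᶠ[𝓝 x] fun _ => φ x := by
    filter_upwards [h, hmin] with y h₁ h₂ using le_antisymm h₁ h₂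
  have hzero : deriv (deriv φ) x = 0 := by
    rw [hconst.deriv.deriv_eq]
    simp
  exact hpos.ne' hzero

lemma deriv_deriv_comp_line {d : ℕ} {g : (Fin d → ℝ) → ℝ} (hg : ContDiff ℝ 2 g) (i : Fin d)
    (x : Fin d → ℝ) :
    deriv (deriv fun s : ℝ => g (x + s • Pi.single i 1)) 0 = spatialPD2 d g i i x := by
  have hline : ∀ s : ℝ,
      HasDerivAt (fun s : ℝ => x + s • (Pi.single i 1 : Fin d → ℝ)) (Pi.single i 1) s := by
    intro s
    simpa using ((hasDerivAt_id s).smul_const (Pi.single i 1 : Fin d → ℝ)).const_add x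
  have h₁ : (deriv fun s : ℝ => g (x + s • Pi.single i 1)) =
      fun s : ℝ => fderiv ℝ g (x + s • Pi.single i 1) (Pi.single i 1) := by
    ext s
    exact (((hg.differentiable (by norm_num)) _).hasFDerivAt.comp_hasDerivAt s (hline s)).deriv
  rw [h₁]
  have hdiff : Differentiable ℝ (fun y => fderiv ℝ g y (Pi.single i 1)) :=
    ((hg.fderiv_right (m := 1) (by norm_num)).clm_apply contDiff_const).differentiable
      (by norm_num)
  have h₂ := (hdiff (x + (0 : ℝ) • Pi.single i 1)).hasFDerivAt.comp_hasDerivAt (0 : ℝ) (hline 0)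
  rw [zero_smul, add_zero] at h₂
  exact h₂.deriv

lemma laplacian_nonpos_of_forall_le {d : ℕ} {g : (Fin d → ℝ) → ℝ} (hg : ContDiff ℝ 2 g)
    {x : Fin d → ℝ} (hx : ∀ y, g y ≤ g x) : laplacian d g x ≤ 0 := by
  refine Finset.sum_nonpos fun i _ => ?_
  rw [← deriv_deriv_comp_line hg]
  refine deriv_deriv_nonpos_of_isLocalMax (Eventually.of_forall fun s => ?_) ?_
  · simpa using hx _
  · have := hg.continuous
    fun_prop

lemma spatialPD1_sub_const_mul {d : ℕ} {g h : (Fin d → ℝ) → ℝ} (hg : Differentiable ℝ g)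
    (hh : Differentiable ℝ h) (c : ℝ) (i : Fin d) :
    spatialPD1 d (fun y => g y - c * h y) i =
      fun y => spatialPD1 d g i y - c * spatialPD1 d h i y := by
  ext y
  simp only [spatialPD1]
  rw [fderiv_fun_sub (hg y) ((hh y).const_mul c), fderiv_const_mul (hh y)]
  simp

lemma spatialPD1_differentiable {d : ℕ} {g : (Fin d → ℝ) → ℝ} (hg : ContDiff ℝ 2 g)
    (i : Fin d) : Differentiable ℝ (spatialPD1 d g i) :=
  ((hg.fderiv_right (m := 1) (by norm_num)).clm_apply contDiff_const).differentiable
    (by norm_num)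

lemma laplacian_sub_const_mul {d : ℕ} {g h : (Fin d → ℝ) → ℝ} (hg : ContDiff ℝ 2 g)
    (hh : ContDiff ℝ 2 h) (c : ℝ) (x : Fin d → ℝ) :
    laplacian d (fun y => g y - c * h y) x = laplacian d g x - c * laplacian d h x := by
  have key : ∀ i j, spatialPD2 d (fun y => g y - c * h y) i j x =
      spatialPD2 d g i j x - c * spatialPD2 d h i j x := by
    intro i j
    have h₁ := spatialPD1_sub_const_mul (hg.differentiable (by norm_num))
      (hh.differentiable (by norm_num)) c i
    have h₂ := congrFun (spatialPD1_sub_const_mul (spatialPD1_differentiable hg i)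
      (spatialPD1_differentiable hh i) c j) x
    rw [← h₁] at h₂
    exact h₂
  simp only [laplacian, key, Finset.sum_sub_distrib, Finset.mul_sum]

lemma hasFDerivAt_sum_comp_apply {d : ℕ} {φ φ' : ℝ → ℝ} (hφ : ∀ s, HasDerivAt φ (φ' s) s)
    (x : Fin d → ℝ) :
    HasFDerivAt (fun y : Fin d → ℝ => ∑ k, φ (y k))
      (∑ k, φ' (x k) • ContinuousLinearMap.proj (R := ℝ) (φ := fun _ : Fin d => ℝ) k) x :=
  HasFDerivAt.fun_sum fun k _ => (hφ (x k)).comp_hasFDerivAt x (hasFDerivAt_apply k x)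

lemma laplacian_sum_cosh (d : ℕ) (x : Fin d → ℝ) :
    laplacian d (fun y => ∑ k, Real.cosh (y k)) x = ∑ k, Real.cosh (x k) := by
  refine Finset.sum_congr rfl fun i _ => ?_
  have h₁ : (fun y => fderiv ℝ (fun y : Fin d → ℝ => ∑ k, Real.cosh (y k)) y (Pi.single i 1)) =
      fun y => Real.sinh (y i) := by
    ext y
    rw [(hasFDerivAt_sum_comp_apply Real.hasDerivAt_cosh y).fderiv]
    simp [Pi.single_apply]
  have h₂ : HasFDerivAt (fun y : Fin d → ℝ => Real.sinh (y i)) _ x :=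
    (hasFDerivAt_apply i x).sinh
  rw [spatialPD2, h₁, h₂.fderiv]
  simp

lemma exists_forall_mul_pow_le_cosh (c ε : ℝ) (hε : 0 < ε) (m : ℕ) :
    ∃ R : ℝ, ∀ r, R ≤ r → c * (1 + r) ^ m ≤ ε * Real.cosh r := by
  have h₁ : Tendsto (fun r : ℝ => c * ((1 + r) ^ m * Real.exp (-(1 + r)))) atTop (𝓝 (c * 0)) :=
    ((Real.tendsto_pow_mul_exp_neg_atTop_nhds_zero m).comp
      (tendsto_atTop_add_const_left atTop 1 tendsto_id)).const_mul c
  have hpos : c * 0 < ε * Real.exp (-1) / 2 := by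
    rw [mul_zero]
    positivity
  obtain ⟨R, hR⟩ := eventually_atTop.1 (h₁.eventually (eventually_lt_nhds hpos))
  refine ⟨R, fun r hr => ?_⟩
  have h₂ := (mul_lt_mul_of_pos_right (hR r hr) (Real.exp_pos (1 + r))).le
  have h₃ : Real.exp (-(1 + r)) * Real.exp (1 + r) = 1 := by
    rw [← Real.exp_add]
    simp
  have h₄ : Real.exp (-1) * Real.exp (1 + r) = Real.exp r := by
    rw [← Real.exp_add]
    simp
  have h₅ : Real.exp r / 2 ≤ Real.cosh r := by
    rw [Real.cosh_eq]
    linarith [Real.exp_pos (-r)]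
  calc c * (1 + r) ^ m = c * ((1 + r) ^ m * Real.exp (-(1 + r))) * Real.exp (1 + r) := by
        linear_combination (-(c * (1 + r) ^ m)) * h₃
    _ ≤ ε * Real.exp (-1) / 2 * Real.exp (1 + r) := h₂
    _ = ε * (Real.exp r / 2) := by linear_combination (ε / 2) * h₄
    _ ≤ ε * Real.cosh r := by gcongr

lemma cosh_norm_le_sum {d : ℕ} (hd : 0 < d) (x : Fin d → ℝ) :
    Real.cosh ‖x‖ ≤ ∑ k, Real.cosh (x k) := by
  have : Nonempty (Fin d) := ⟨⟨0, hd⟩⟩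
  obtain ⟨i, hi⟩ := Finite.exists_max fun k => |x k|
  have hnorm : ‖x‖ ≤ |x i| := (pi_norm_le_iff_of_nonneg (abs_nonneg _)).2 hi
  calc Real.cosh ‖x‖ ≤ Real.cosh (x i) := by
        rw [Real.cosh_le_cosh]
        simpa using hnorm
    _ ≤ ∑ k, Real.cosh (x k) :=
        Finset.single_le_sum (f := fun k => Real.cosh (x k))
          (fun k _ => (Real.cosh_pos _).le) (Finset.mem_univ i)

/-- A differentiable function on `[a, b]` has nonnegative derivative at a maximum `t > a`. -/
lemma hasDerivWithinAt_nonneg_of_forall_le {φ : ℝ → ℝ} {a b t φ' : ℝ} (hat : a < t) (htb : t ≤ b)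
    (hφ : HasDerivWithinAt φ φ' (Icc a b) t) (hmax : ∀ s ∈ Icc a b, φ s ≤ φ t) : 0 ≤ φ' := by
  have h₁ : HasDerivWithinAt φ φ' (Ico a t) t :=
    hφ.mono fun s hs => ⟨hs.1, hs.2.le.trans htb⟩
  have hne : (𝓝[Ico a t] t).NeBot := by
    rw [← mem_closure_iff_nhdsWithin_neBot, closure_Ico hat.ne]
    exact right_mem_Icc.2 hat.le
  rw [hasDerivWithinAt_iff_tendsto_slope' (by simp)] at h₁
  refine ge_of_tendsto h₁ (eventually_nhdsWithin_of_forall fun s hs => ?_)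
  rw [slope_def_field]
  exact div_nonneg_of_nonpos (by linarith [hmax s ⟨hs.1, hs.2.le.trans htb⟩]) (by linarith [hs.2])

/-- Weak maximum principle for the heat equation on the whole space, in the class of
functions growing at most polynomially. -/
theorem heat_nonpos_of_initial_nonpos {d : ℕ} (hd : 0 < d) {a b : ℝ}
    {w : ℝ → (Fin d → ℝ) → ℝ}
    (hcont : ContinuousOn (fun p : ℝ × (Fin d → ℝ) => w p.1 p.2) (Icc a b ×ˢ univ))
    (hC2 : ∀ t ∈ Icc a b, ContDiff ℝ 2 (w t))
    (hheat : ∀ t ∈ Icc a b, ∀ x,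
      HasDerivWithinAt (fun s => w s x) (laplacian d (w t) x) (Icc a b) t)
    (hgrowth : ∃ (c : ℝ) (m : ℕ), ∀ t ∈ Icc a b, ∀ x, |w t x| ≤ c * (1 + ‖x‖) ^ m)
    (hinit : ∀ x, w a x ≤ 0) : ∀ t ∈ Icc a b, ∀ x, w t x ≤ 0 := by
  obtain ⟨c, m, hcm⟩ := hgrowth
  set S : (Fin d → ℝ) → ℝ := fun y => ∑ k, Real.cosh (y k) with hS
  have hSc : ContDiff ℝ 2 S :=
    ContDiff.sum fun k _ => Real.contDiff_cosh.comp (contDiff_apply ℝ ℝ k)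
  have hSpos : ∀ x, 0 < S x := fun x => (Real.cosh_pos _).trans_le (cosh_norm_le_sum hd x)
  have barrier : ∀ ε > 0, ∀ t ∈ Icc a b, ∀ x,
      w t x - ε * Real.exp (2 * (t - a)) * S x ≤ 0 := by
    intro ε hε t₀ ht₀ x₀
    by_contra! hpos
    set z : ℝ → (Fin d → ℝ) → ℝ := fun t x => w t x - ε * Real.exp (2 * (t - a)) * S x with hz
    obtain ⟨R, hR⟩ := exists_forall_mul_pow_le_cosh c ε hε m
    have hout : ∀ t ∈ Icc a b, ∀ x, R ≤ ‖x‖ → z t x ≤ 0 := by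
      intro t ht x hx
      have h₁ := (le_abs_self _).trans (hcm t ht x)
      have h₂ := hR _ hx
      have h₃ : ε * Real.cosh ‖x‖ ≤ ε * Real.exp (2 * (t - a)) * S x := by
        rw [mul_assoc]
        have h₄ : 1 ≤ Real.exp (2 * (t - a)) := Real.one_le_exp (by linarith [ht.1])
        have h₅ := cosh_norm_le_sum hd x
        have h₆ := hSpos x
        gcongr
        nlinarith
      simp only [hz]
      linarith
    have hcpt : IsCompact (Icc a b ×ˢ Metric.closedBall (0 : Fin d → ℝ) R) :=
      isCompact_Icc.prod (isCompact_closedBall _ _)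
    have hx₀ : ‖x₀‖ ≤ R := by
      by_contra! h
      exact absurd (hout t₀ ht₀ x₀ h.le) (not_le.2 hpos)
    have hzc : ContinuousOn (fun p : ℝ × (Fin d → ℝ) => z p.1 p.2) (Icc a b ×ˢ univ) := by
      have := hSc.continuous
      exact hcont.sub (by fun_prop)
    obtain ⟨⟨t, x⟩, ⟨ht, -⟩, hmax⟩ := hcpt.exists_isMaxOn ⟨(t₀, x₀), ht₀, by simpa using hx₀⟩
      (hzc.mono (prod_mono_right (subset_univ _)))
    have htx : 0 < z t x := hpos.trans_le (hmax (⟨ht₀, by simpa using hx₀⟩ :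
      (t₀, x₀) ∈ Icc a b ×ˢ Metric.closedBall (0 : Fin d → ℝ) R))
    have hglob : ∀ s ∈ Icc a b, ∀ y, z s y ≤ z t x := by
      intro s hs y
      rcases le_total ‖y‖ R with h | h
      · exact hmax (⟨hs, by simpa using h⟩ :
          (s, y) ∈ Icc a b ×ˢ Metric.closedBall (0 : Fin d → ℝ) R)
      · exact (hout s hs y h).trans htx.le
    have hat : a < t := by
      refine lt_of_le_of_ne ht.1 fun h => ?_
      subst h
      have := hinit x
      have h₁ := mul_pos (mul_pos hε (Real.exp_pos (2 * (a - a)))) (hSpos x)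
      simp only [hz] at htx
      linarith
    have hE : HasDerivAt (fun s => ε * Real.exp (2 * (s - a)) * S x)
        (ε * (Real.exp (2 * (t - a)) * 2) * S x) t := by
      have h₁ : HasDerivAt (fun s => 2 * (s - a)) 2 t := by
        simpa using ((hasDerivAt_id t).sub_const a).const_mul 2
      exact (h₁.exp.const_mul ε).mul_const (S x)
    have hd₁ := hasDerivWithinAt_nonneg_of_forall_le hat ht.2
      ((hheat t ht x).sub hE.hasDerivWithinAt) fun s hs => hglob s hs x
    have hzC2 : ContDiff ℝ 2 (z t) := (hC2 t ht).sub (contDiff_const.mul hSc)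
    have hd₂ := laplacian_nonpos_of_forall_le hzC2 fun y => hglob t ht y
    simp only [hz] at hd₂
    rw [laplacian_sub_const_mul (hC2 t ht) hSc, hS, laplacian_sum_cosh] at hd₂
    have h₁ := mul_pos (mul_pos hε (Real.exp_pos (2 * (t - a)))) (hSpos x)
    simp only [hS] at h₁ hd₁
    linarith
  intro t ht x
  have hlim : Tendsto (fun ε : ℝ => w t x - ε * Real.exp (2 * (t - a)) * S x) (𝓝[>] 0)
      (𝓝 (w t x - 0 * Real.exp (2 * (t - a)) * S x)) :=
    tendsto_nhdsWithin_of_tendsto_nhds (Continuous.tendsto (by fun_prop) 0)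
  have h := le_of_tendsto hlim (eventually_nhdsWithin_of_forall fun ε hε => barrier ε hε t ht x)
  simpa using h

end MaximumPrinciple

section PolynomialGrowth

variable {E F F' : Type*} [NormedAddCommGroup E] [NormedAddCommGroup F] [NormedAddCommGroup F']

/-- A continuous function growing at most polynomially. -/
structure PolyGrowth (g : E → F) : Prop where
  continuous : Continuous g
  bound : ∃ (C : ℝ) (m : ℕ), 0 ≤ C ∧ ∀ x, ‖g x‖ ≤ C * (1 + ‖x‖) ^ m

lemma PolyGrowth.of_norm_le {g : E → F} (hg : PolyGrowth g) {h : E → F'} (hc : Continuous h)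
    {K : ℝ} (hK : ∀ x, ‖h x‖ ≤ K * ‖g x‖) : PolyGrowth h := by
  obtain ⟨C, m, hC, hb⟩ := hg.bound
  refine ⟨hc, |K| * C, m, by positivity, fun x => (hK x).trans ?_⟩
  calc K * ‖g x‖ ≤ |K| * ‖g x‖ := by gcongr; exact le_abs_self K
    _ ≤ |K| * (C * (1 + ‖x‖) ^ m) := by gcongr; exact hb x
    _ = |K| * C * (1 + ‖x‖) ^ m := by ring

lemma PolyGrowth.const (c : F) : PolyGrowth fun _ : E => c :=
  ⟨continuous_const, ‖c‖, 0, norm_nonneg _, fun x => by simp⟩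

lemma PolyGrowth.id : PolyGrowth fun x : E => x :=
  ⟨continuous_id, 1, 1, zero_le_one, fun x => by simp⟩

lemma PolyGrowth.add {g h : E → F} (hg : PolyGrowth g) (hh : PolyGrowth h) :
    PolyGrowth fun x => g x + h x := by
  obtain ⟨C, m, hC, hb⟩ := hg.bound
  obtain ⟨C', m', hC', hb'⟩ := hh.bound
  refine ⟨hg.continuous.add hh.continuous, C + C', max m m', by positivity, fun x => ?_⟩
  have h₁ : (1 : ℝ) ≤ 1 + ‖x‖ := by linarith [norm_nonneg x]
  calc ‖g x + h x‖ ≤ ‖g x‖ + ‖h x‖ := norm_add_le _ _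
    _ ≤ C * (1 + ‖x‖) ^ m + C' * (1 + ‖x‖) ^ m' := add_le_add (hb x) (hb' x)
    _ ≤ C * (1 + ‖x‖) ^ max m m' + C' * (1 + ‖x‖) ^ max m m' := by
        gcongr
        · exact le_max_left _ _
        · exact le_max_right _ _
    _ = (C + C') * (1 + ‖x‖) ^ max m m' := by ring

lemma PolyGrowth.sum {ι : Type*} {s : Finset ι} {g : ι → E → F}
    (hg : ∀ i ∈ s, PolyGrowth (g i)) : PolyGrowth fun x => ∑ i ∈ s, g i x := by
  classical
  induction s using Finset.induction_on with
  | empty => simpa using PolyGrowth.const (0 : F)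
  | insert a s ha ih =>
    simp only [Finset.sum_insert ha]
    exact (hg a (by simp)).add (ih fun i hi => hg i (by simp [hi]))

lemma PolyGrowth.norm_mul_norm {g : E → F} {h : E → F'} (hg : PolyGrowth g)
    (hh : PolyGrowth h) : PolyGrowth fun x => ‖g x‖ * ‖h x‖ := by
  obtain ⟨C, m, hC, hb⟩ := hg.bound
  obtain ⟨C', m', hC', hb'⟩ := hh.bound
  refine ⟨hg.continuous.norm.mul hh.continuous.norm, C * C', m + m', by positivity, fun x => ?_⟩
  calc ‖‖g x‖ * ‖h x‖‖ = ‖g x‖ * ‖h x‖ := by simp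
    _ ≤ (C * (1 + ‖x‖) ^ m) * (C' * (1 + ‖x‖) ^ m') :=
        mul_le_mul (hb x) (hb' x) (norm_nonneg _) (by positivity)
    _ = C * C' * (1 + ‖x‖) ^ (m + m') := by ring

lemma PolyGrowth.comp {φ : ℝ → ℝ} {g : E → ℝ} (hφ : PolyGrowth φ) (hg : PolyGrowth g) :
    PolyGrowth fun x => φ (g x) := by
  obtain ⟨C, m, hC, hb⟩ := hφ.bound
  obtain ⟨C', m', hC', hb'⟩ := hg.bound
  refine ⟨hφ.continuous.comp hg.continuous, C * (1 + C') ^ m, m' * m, by positivity,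
    fun x => (hb (g x)).trans ?_⟩
  have h₁ : (1 : ℝ) ≤ (1 + ‖x‖) ^ m' := one_le_pow₀ (by linarith [norm_nonneg x])
  calc C * (1 + ‖g x‖) ^ m ≤ C * ((1 + C') * (1 + ‖x‖) ^ m') ^ m := by
        gcongr
        linarith [hb' x]
    _ = C * (1 + C') ^ m * (1 + ‖x‖) ^ (m' * m) := by rw [mul_pow, pow_mul]; ring

lemma exists_pow_bound_of_rpow_bound {d : ℕ} (C : ℝ) {q : ℝ} :
    ∃ (C' : ℝ) (m : ℕ), 0 ≤ C' ∧ ∀ x : Fin d → ℝ,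
      C * (1 + ∑ i, |x i|) ^ q ≤ C' * (1 + ‖x‖) ^ m := by
  refine ⟨|C| * (d + 1) ^ ⌈q⌉₊, ⌈q⌉₊, by positivity, fun x => ?_⟩
  have hs : 0 ≤ ∑ i, |x i| := Finset.sum_nonneg fun i _ => abs_nonneg _
  have h₁ : ∑ i, |x i| ≤ d * ‖x‖ := by
    calc ∑ i, |x i| ≤ ∑ _i : Fin d, ‖x‖ := Finset.sum_le_sum fun i _ => norm_le_pi_norm x i
      _ = d * ‖x‖ := by simp
  calc C * (1 + ∑ i, |x i|) ^ q ≤ |C| * (1 + ∑ i, |x i|) ^ q := by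
        gcongr
        exact le_abs_self C
    _ ≤ |C| * (1 + ∑ i, |x i|) ^ (⌈q⌉₊ : ℝ) := by
        gcongr
        · linarith
        · exact Nat.le_ceil q
    _ = |C| * (1 + ∑ i, |x i|) ^ ⌈q⌉₊ := by rw [Real.rpow_natCast]
    _ ≤ |C| * ((d + 1) * (1 + ‖x‖)) ^ ⌈q⌉₊ := by
        gcongr
        nlinarith [norm_nonneg x, (Nat.cast_nonneg d : (0 : ℝ) ≤ d)]
    _ = |C| * (d + 1) ^ ⌈q⌉₊ * (1 + ‖x‖) ^ ⌈q⌉₊ := by rw [mul_pow]; ring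

lemma PolyGrowth.of_rpow_bound {d : ℕ} {g : (Fin d → ℝ) → F} (hc : Continuous g) {C q : ℝ}
    (hb : ∀ x, ‖g x‖ ≤ C * (1 + ∑ i, |x i|) ^ q) : PolyGrowth g := by
  obtain ⟨C', m, hC', h⟩ := exists_pow_bound_of_rpow_bound (d := d) C (q := q)
  exact ⟨hc, C', m, hC', fun x => (hb x).trans (h x)⟩

variable [NormedSpace ℝ F]

lemma PolyGrowth.smul {c : E → ℝ} {g : E → F} (hc : PolyGrowth c) (hg : PolyGrowth g) :
    PolyGrowth fun x => c x • g x :=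
  (hc.norm_mul_norm hg).of_norm_le (hc.continuous.smul hg.continuous) (K := 1)
    fun x => by simp [norm_smul]

lemma norm_clm_le_sum {d : ℕ} (L : (Fin d → ℝ) →L[ℝ] F) :
    ‖L‖ ≤ ∑ i, ‖L (Pi.single i 1)‖ := by
  refine L.opNorm_le_bound (Finset.sum_nonneg fun i _ => norm_nonneg _) fun x => ?_
  have hx : x = ∑ i, x i • (Pi.single i 1 : Fin d → ℝ) := by
    ext j
    simp [Pi.single_apply]
  calc ‖L x‖ = ‖∑ i, x i • L (Pi.single i 1)‖ := by
        conv_lhs => rw [hx]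
        simp only [map_sum, map_smul]
    _ ≤ ∑ i, ‖x i • L (Pi.single i 1)‖ := norm_sum_le _ _
    _ ≤ ∑ i, ‖L (Pi.single i 1)‖ * ‖x‖ := by
        refine Finset.sum_le_sum fun i _ => ?_
        rw [norm_smul, mul_comm]
        gcongr
        exact norm_le_pi_norm x i
    _ = (∑ i, ‖L (Pi.single i 1)‖) * ‖x‖ := (Finset.sum_mul ..).symm

lemma PolyGrowth.of_apply_single {d : ℕ} {L : E → (Fin d → ℝ) →L[ℝ] F} (hc : Continuous L)
    (hL : ∀ i, PolyGrowth fun x => L x (Pi.single i 1)) : PolyGrowth L := by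
  have h₁ : PolyGrowth fun x => ∑ i, (1 : ℝ) • ‖L x (Pi.single i 1)‖ :=
    PolyGrowth.sum fun i _ => (PolyGrowth.const (1 : ℝ)).smul
      ((hL i).of_norm_le (hL i).continuous.norm (K := 1) fun x => by simp)
  refine h₁.of_norm_le hc (K := 1) fun x => ?_
  rw [one_mul]
  refine (norm_clm_le_sum (L x)).trans ((le_abs_self _).trans (le_of_eq ?_))
  simp

variable [NormedSpace ℝ E]

/-- A `C²` function growing, together with its first two derivatives, at most polynomially. -/
structure PolyGrowthC2 (g : E → F) : Prop where
  contDiff : ContDiff ℝ 2 g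
  growth : PolyGrowth g
  growth_fderiv : PolyGrowth (fderiv ℝ g)
  growth_fderiv_fderiv : PolyGrowth (fderiv ℝ (fderiv ℝ g))

lemma PolyGrowth.fderiv_apply {g : E → F} (hg : PolyGrowth (fderiv ℝ g)) (v : E) :
    PolyGrowth fun x => fderiv ℝ g x v :=
  hg.of_norm_le (hg.continuous.clm_apply continuous_const) (K := ‖v‖) fun x => by
    rw [mul_comm]
    exact (fderiv ℝ g x).le_opNorm v

lemma PolyGrowthC2.differentiable {g : E → F} (hg : PolyGrowthC2 g) : Differentiable ℝ g :=
  hg.contDiff.differentiable (by norm_num)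

lemma PolyGrowthC2.differentiable_fderiv {g : E → F} (hg : PolyGrowthC2 g) :
    Differentiable ℝ (fderiv ℝ g) :=
  (hg.contDiff.fderiv_right (m := 1) (by norm_num)).differentiable (by norm_num)

lemma PolyGrowthC2.differentiable_fderiv_apply {g : E → F} (hg : PolyGrowthC2 g) (v : E) :
    Differentiable ℝ fun x => fderiv ℝ g x v := fun x =>
  (hg.differentiable_fderiv x).clm_apply (differentiableAt_const v)

lemma PolyGrowthC2.growth_fderiv_fderiv_apply {g : E → F} (hg : PolyGrowthC2 g) (v : E) :
    PolyGrowth (fderiv ℝ fun x => fderiv ℝ g x v) := by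
  have h₁ : (fderiv ℝ fun x => fderiv ℝ g x v) =
      fun x => (fderiv ℝ (fderiv ℝ g) x).flip v := by
    ext x w
    rw [fderiv_clm_apply (hg.differentiable_fderiv x) (differentiableAt_const v)]
    simp
  rw [h₁]
  refine hg.growth_fderiv_fderiv.of_norm_le (K := ‖v‖) ?_ fun x => ?_
  · have := hg.growth_fderiv_fderiv.continuous
    exact ((ContinuousLinearMap.flipₗᵢ ℝ E E F).continuous.comp this).clm_apply continuous_const
  · rw [mul_comm, ← ContinuousLinearMap.opNorm_flip (fderiv ℝ (fderiv ℝ g) x)]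
    exact ContinuousLinearMap.le_opNorm _ _

lemma PolyGrowthC2.comp {φ : ℝ → ℝ} (hφ : ContDiff ℝ 2 φ) (hφ₀ : PolyGrowth φ)
    (hφ₁ : PolyGrowth (deriv φ)) (hφ₂ : PolyGrowth (deriv (deriv φ))) {g : E → ℝ}
    (hg : PolyGrowthC2 g) : PolyGrowthC2 fun x => φ (g x) := by
  have hd : Differentiable ℝ φ := hφ.differentiable (by norm_num)
  have hd' : Differentiable ℝ (deriv φ) :=
    (ContDiff.deriv' (n := 1) (by simpa [one_add_one_eq_two] using hφ)).differentiable
      (by norm_num)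
  have h₁ : ∀ ψ : ℝ → ℝ, Differentiable ℝ ψ →
      (fderiv ℝ fun x => ψ (g x)) = fun x => deriv ψ (g x) • fderiv ℝ g x := by
    intro ψ hψ
    ext1 x
    exact ((hψ _).hasDerivAt.comp_hasFDerivAt x (hg.differentiable x).hasFDerivAt).fderiv
  have h₂ : fderiv ℝ (fderiv ℝ fun x => φ (g x)) = fun x =>
      deriv φ (g x) • fderiv ℝ (fderiv ℝ g) x +
        (deriv (deriv φ) (g x) • fderiv ℝ g x).smulRight (fderiv ℝ g x) := by
    ext1 x
    rw [h₁ φ hd, fderiv_fun_smul (c := fun y => deriv φ (g y)) ((hd' _).comp x (hg.differentiable x))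
      (hg.differentiable_fderiv x), h₁ _ hd']
  refine ⟨hφ.comp hg.contDiff, hφ₀.comp hg.growth, ?_, ?_⟩
  · rw [h₁ φ hd]
    exact (hφ₁.comp hg.growth).smul hg.growth_fderiv
  · rw [h₂]
    refine ((hφ₁.comp hg.growth).smul hg.growth_fderiv_fderiv).add ?_
    have h₃ := (hφ₂.comp hg.growth).smul hg.growth_fderiv
    refine (h₃.norm_mul_norm hg.growth_fderiv).of_norm_le (K := 1) ?_ fun x => ?_
    · have := h₃.continuous
      have := hg.growth_fderiv.continuous
      fun_prop
    · simp [ContinuousLinearMap.norm_smulRight_apply]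

lemma PolyGrowth.of_deriv_bounded {φ : ℝ → ℝ} (hφ : Differentiable ℝ φ) {K : ℝ}
    (hK : ∀ y, |deriv φ y| ≤ K) : PolyGrowth φ := by
  have hK0 : 0 ≤ K := (abs_nonneg _).trans (hK 0)
  refine ⟨hφ.continuous, |φ 0| + K, 1, by positivity, fun y => ?_⟩
  have h₁ := Convex.norm_image_sub_le_of_norm_deriv_le (f := φ) (C := K) (s := Set.univ)
    (fun x _ => hφ x) (fun x _ => hK x) convex_univ (mem_univ 0) (mem_univ y)
  have h₂ := norm_sub_norm_le (φ y) (φ 0)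
  simp only [sub_zero, Real.norm_eq_abs] at *
  nlinarith [abs_nonneg y, abs_nonneg (φ 0)]

lemma PolyGrowthC2.of_spatialPD {d : ℕ} {g : (Fin d → ℝ) → ℝ} (hg : ContDiff ℝ 2 g)
    (h₀ : PolyGrowth g) (h₁ : ∀ i, PolyGrowth (spatialPD1 d g i))
    (h₂ : ∀ i j, PolyGrowth (spatialPD2 d g i j)) : PolyGrowthC2 g := by
  have hf : ContDiff ℝ 1 (fderiv ℝ g) := hg.fderiv_right (by norm_num)
  have hff : Continuous (fderiv ℝ (fderiv ℝ g)) := hf.continuous_fderiv (by norm_num)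
  refine ⟨hg, h₀, .of_apply_single hf.continuous h₁, .of_apply_single hff fun j =>
    .of_apply_single (hff.clm_apply continuous_const) fun i => ?_⟩
  convert h₂ i j using 2 with x
  rw [spatialPD2, fderiv_clm_apply (hf.differentiable (by norm_num) x) (differentiableAt_const _)]
  simp

end PolynomialGrowth

section GaussianAverage

open Filter Topology

/-- The standard Gaussian density on `ℝ^d`. -/
def gaussDensity (d : ℕ) (z : Fin d → ℝ) : ℝ :=
  (√(2 * Real.pi))⁻¹ ^ d * Real.exp (-(∑ i, z i ^ 2) / 2)

lemma gaussDensity_eq_prod (d : ℕ) (z : Fin d → ℝ) :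
    gaussDensity d z = ∏ i, gaussianPDFReal 0 1 (z i) := by
  simp only [gaussDensity, gaussianPDFReal, Finset.prod_mul_distrib, Finset.prod_const,
    ← Real.exp_sum]
  simp [Finset.sum_div, neg_div]

lemma gaussDensity_nonneg (d : ℕ) (z : Fin d → ℝ) : 0 ≤ gaussDensity d z := by
  unfold gaussDensity
  positivity

lemma continuous_gaussDensity (d : ℕ) : Continuous (gaussDensity d) := by
  unfold gaussDensity
  fun_prop

lemma hasFDerivAt_gaussDensity (d : ℕ) (z : Fin d → ℝ) :
    HasFDerivAt (gaussDensity d) (-(gaussDensity d z •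
      ∑ k, z k • ContinuousLinearMap.proj (R := ℝ) (φ := fun _ : Fin d => ℝ) k)) z := by
  have h₁ : ∀ s : ℝ, HasDerivAt (fun s : ℝ => -(s ^ 2) / 2) (-s) s := fun s =>
    ((hasDerivAt_pow 2 s).fun_neg.div_const 2).congr_deriv (by simp; ring)
  have h₂ := ((hasFDerivAt_sum_comp_apply h₁ z).exp).const_mul ((√(2 * Real.pi))⁻¹ ^ d)
  have h₃ : ∀ y : Fin d → ℝ, ∑ k, -(y k ^ 2) / 2 = -(∑ k, y k ^ 2) / 2 := fun y => by
    rw [← Finset.sum_div, Finset.sum_neg_distrib]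
  simp only [h₃] at h₂
  refine h₂.congr_fderiv ?_
  ext v
  simp [gaussDensity, Finset.mul_sum, mul_assoc]

lemma fderiv_gaussDensity_single (d : ℕ) (z : Fin d → ℝ) (i : Fin d) :
    fderiv ℝ (gaussDensity d) z (Pi.single i 1) = -(gaussDensity d z * z i) := by
  rw [(hasFDerivAt_gaussDensity d z).fderiv]
  simp [Pi.single_apply]

lemma integral_gaussDensity (d : ℕ) : ∫ z, gaussDensity d z = 1 := by
  simp_rw [gaussDensity_eq_prod]
  rw [integral_fintype_prod_volume_eq_prod (fun _ : Fin d => gaussianPDFReal 0 1)]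
  simp [integral_gaussianPDFReal_eq_one]

lemma one_add_norm_pow_le (d m : ℕ) (z : Fin d → ℝ) :
    (1 + ‖z‖) ^ m ≤ m.factorial * Real.exp 2 * Real.exp ((∑ i, z i ^ 2) / 4) := by
  have h₁ : ‖z‖ ^ 2 ≤ ∑ i, z i ^ 2 := by
    refine Real.le_sqrt (norm_nonneg _) (Finset.sum_nonneg fun i _ => sq_nonneg _) |>.1 ?_
    refine (pi_norm_le_iff_of_nonneg (Real.sqrt_nonneg _)).2 fun i => Real.abs_le_sqrt ?_
    exact Finset.single_le_sum (f := fun i => z i ^ 2) (fun i _ => sq_nonneg _)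
      (Finset.mem_univ i)
  have h₂ := Real.pow_div_factorial_le_exp (x := 1 + ‖z‖) (by positivity) m
  rw [div_le_iff₀ (by positivity)] at h₂
  calc (1 + ‖z‖) ^ m ≤ Real.exp (1 + ‖z‖) * m.factorial := h₂
    _ ≤ Real.exp (2 + (∑ i, z i ^ 2) / 4) * m.factorial := by
        refine mul_le_mul_of_nonneg_right (Real.exp_le_exp.2 ?_) (by positivity)
        nlinarith [sq_nonneg (‖z‖ - 2)]
    _ = m.factorial * Real.exp 2 * Real.exp ((∑ i, z i ^ 2) / 4) := by
        rw [Real.exp_add]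
        ring

lemma integrable_gaussDensity_mul_pow (d m : ℕ) :
    Integrable fun z : Fin d → ℝ => gaussDensity d z * (1 + ‖z‖) ^ m := by
  have h₁ : Integrable fun z : Fin d → ℝ => ∏ i, Real.exp (-(1 / 4) * z i ^ 2) :=
    Integrable.fintype_prod (μ := fun _ => volume)
      (f := fun (_ : Fin d) (s : ℝ) => Real.exp (-(1 / 4) * s ^ 2))
      fun _ => integrable_exp_neg_mul_sq (by norm_num)
  refine (h₁.const_mul ((√(2 * Real.pi))⁻¹ ^ d * (m.factorial * Real.exp 2))).mono'
    (((continuous_gaussDensity d).mul (by fun_prop)).aestronglyMeasurable)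
    (Eventually.of_forall fun z => ?_)
  rw [Real.norm_of_nonneg (mul_nonneg (gaussDensity_nonneg d z) (by positivity))]
  calc gaussDensity d z * (1 + ‖z‖) ^ m
      ≤ gaussDensity d z * (m.factorial * Real.exp 2 * Real.exp ((∑ i, z i ^ 2) / 4)) :=
        mul_le_mul_of_nonneg_left (one_add_norm_pow_le d m z) (gaussDensity_nonneg d z)
    _ = (√(2 * Real.pi))⁻¹ ^ d * (m.factorial * Real.exp 2) *
          (Real.exp (-(∑ i, z i ^ 2) / 2) * Real.exp ((∑ i, z i ^ 2) / 4)) := by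
        rw [gaussDensity]
        ring
    _ = _ := by
        rw [← Real.exp_add, ← Real.exp_sum, ← Finset.mul_sum]
        ring_nf

variable {d : ℕ} {F : Type*} [NormedAddCommGroup F] [NormedSpace ℝ F]

/-- The expectation of `g (x + s • Z)` for a standard Gaussian vector `Z` in `ℝ^d`. -/
def gaussAverage (g : (Fin d → ℝ) → F) (s : ℝ) (x : Fin d → ℝ) : F :=
  ∫ z, gaussDensity d z • g (x + s • z)

lemma norm_gaussDensity_smul_le {g : (Fin d → ℝ) → F} {C : ℝ} {m : ℕ} (hC : 0 ≤ C)
    (hb : ∀ x, ‖g x‖ ≤ C * (1 + ‖x‖) ^ m) (s : ℝ) (x z : Fin d → ℝ) :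
    ‖gaussDensity d z • g (x + s • z)‖ ≤
      C * ((1 + ‖x‖) * (1 + |s|)) ^ m * (gaussDensity d z * (1 + ‖z‖) ^ m) := by
  have h₁ : 1 + ‖x + s • z‖ ≤ (1 + ‖x‖) * (1 + |s|) * (1 + ‖z‖) := by
    have h₂ := norm_add_le x (s • z)
    rw [norm_smul, Real.norm_eq_abs] at h₂
    have hx := norm_nonneg x
    have hz := norm_nonneg z
    have hs := abs_nonneg s
    have : 0 ≤ ‖x‖ * |s| + ‖x‖ * ‖z‖ + ‖x‖ * |s| * ‖z‖ + |s| + ‖z‖ := by positivity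
    linarith
  rw [norm_smul, Real.norm_of_nonneg (gaussDensity_nonneg d z)]
  calc gaussDensity d z * ‖g (x + s • z)‖
      ≤ gaussDensity d z * (C * ((1 + ‖x‖) * (1 + |s|) * (1 + ‖z‖)) ^ m) := by
        refine mul_le_mul_of_nonneg_left ((hb _).trans ?_) (gaussDensity_nonneg d z)
        gcongr
    _ = _ := by
        rw [mul_pow _ (1 + ‖z‖)]
        ring

lemma aestronglyMeasurable_gaussDensity_smul {g : (Fin d → ℝ) → F} (hg : Continuous g)
    (s : ℝ) (x : Fin d → ℝ) :
    AEStronglyMeasurable fun z => gaussDensity d z • g (x + s • z) := by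
  have := continuous_gaussDensity d
  exact Continuous.aestronglyMeasurable (by fun_prop)

lemma PolyGrowth.integrable_gaussDensity_smul {g : (Fin d → ℝ) → F} (hg : PolyGrowth g)
    (s : ℝ) (x : Fin d → ℝ) : Integrable fun z => gaussDensity d z • g (x + s • z) := by
  obtain ⟨C, m, hC, hb⟩ := hg.bound
  exact ((integrable_gaussDensity_mul_pow d m).const_mul _).mono'
    (aestronglyMeasurable_gaussDensity_smul hg.continuous s x)
    (Eventually.of_forall (norm_gaussDensity_smul_le hC hb s x))

lemma norm_gaussDensity_smul_le_pow_succ {g : (Fin d → ℝ) → F} {C : ℝ} {m : ℕ} (hC : 0 ≤ C)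
    (hb : ∀ x, ‖g x‖ ≤ C * (1 + ‖x‖) ^ m) (s : ℝ) (x z : Fin d → ℝ) {r : ℝ} (hr : r ≤ ‖z‖) :
    gaussDensity d z * (‖g (x + s • z)‖ * r) ≤
      C * ((1 + ‖x‖) * (1 + |s|)) ^ m * (gaussDensity d z * (1 + ‖z‖) ^ (m + 1)) := by
  have h₁ := norm_gaussDensity_smul_le hC hb s x z
  rw [norm_smul, Real.norm_of_nonneg (gaussDensity_nonneg d z)] at h₁
  have h₂ : 0 ≤ gaussDensity d z * ‖g (x + s • z)‖ :=
    mul_nonneg (gaussDensity_nonneg d z) (norm_nonneg _)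
  calc gaussDensity d z * (‖g (x + s • z)‖ * r)
      = gaussDensity d z * ‖g (x + s • z)‖ * r := by ring
    _ ≤ gaussDensity d z * ‖g (x + s • z)‖ * (1 + ‖z‖) :=
        mul_le_mul_of_nonneg_left (by linarith) h₂
    _ ≤ C * ((1 + ‖x‖) * (1 + |s|)) ^ m * (gaussDensity d z * (1 + ‖z‖) ^ m) * (1 + ‖z‖) :=
        mul_le_mul_of_nonneg_right h₁ (by positivity)
    _ = _ := by ring

lemma PolyGrowth.integrable_gaussDensity_mul_coord {h : (Fin d → ℝ) → ℝ} (hg : PolyGrowth h)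
    (i : Fin d) (s : ℝ) (x : Fin d → ℝ) :
    Integrable fun z => gaussDensity d z * (z i * h (x + s • z)) := by
  obtain ⟨C, m, hC, hb⟩ := hg.bound
  refine ((integrable_gaussDensity_mul_pow d (m + 1)).const_mul _).mono' ?_
    (Eventually.of_forall fun z => ?_)
    (g := fun z => C * ((1 + ‖x‖) * (1 + |s|)) ^ m * (gaussDensity d z * (1 + ‖z‖) ^ (m + 1)))
  · have := continuous_gaussDensity d
    have := hg.continuous
    exact Continuous.aestronglyMeasurable (by fun_prop)
  · rw [norm_mul, norm_mul, mul_comm ‖z i‖, Real.norm_of_nonneg (gaussDensity_nonneg d z)]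
    exact norm_gaussDensity_smul_le_pow_succ hC hb s x z (norm_le_pi_norm z i)

lemma PolyGrowth.exists_norm_gaussAverage_le {g : (Fin d → ℝ) → F} (hg : PolyGrowth g) :
    ∃ (C : ℝ) (m : ℕ), 0 ≤ C ∧ ∀ s x,
      ‖gaussAverage g s x‖ ≤ C * ((1 + ‖x‖) * (1 + |s|)) ^ m := by
  obtain ⟨C, m, hC, hb⟩ := hg.bound
  have hI : 0 ≤ ∫ z : Fin d → ℝ, gaussDensity d z * (1 + ‖z‖) ^ m :=
    integral_nonneg fun z => mul_nonneg (gaussDensity_nonneg d z) (by positivity)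
  refine ⟨C * ∫ z : Fin d → ℝ, gaussDensity d z * (1 + ‖z‖) ^ m, m, by positivity,
    fun s x => ?_⟩
  refine (norm_integral_le_of_norm_le ((integrable_gaussDensity_mul_pow d m).const_mul _)
    (Eventually.of_forall (norm_gaussDensity_smul_le hC hb s x))).trans (le_of_eq ?_)
  rw [integral_const_mul]
  ring

lemma PolyGrowth.continuous_gaussAverage {g : (Fin d → ℝ) → F} (hg : PolyGrowth g) :
    Continuous fun p : ℝ × (Fin d → ℝ) => gaussAverage g p.1 p.2 := by
  obtain ⟨C, m, hC, hb⟩ := hg.bound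
  refine continuous_iff_continuousAt.2 fun p₀ => ?_
  have hev : ∀ᶠ p : ℝ × (Fin d → ℝ) in 𝓝 p₀,
      C * ((1 + ‖p.2‖) * (1 + |p.1|)) ^ m < C * ((1 + ‖p₀.2‖) * (1 + |p₀.1|)) ^ m + 1 :=
    (Continuous.tendsto (by fun_prop) p₀).eventually (eventually_lt_nhds (lt_add_one _))
  refine continuousAt_of_dominated (bound := fun z =>
      (C * ((1 + ‖p₀.2‖) * (1 + |p₀.1|)) ^ m + 1) * (gaussDensity d z * (1 + ‖z‖) ^ m))
    (Eventually.of_forall fun p =>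
      aestronglyMeasurable_gaussDensity_smul hg.continuous p.1 p.2)
    ?_ ((integrable_gaussDensity_mul_pow d m).const_mul _) (Eventually.of_forall fun z => ?_)
  · filter_upwards [hev] with p hp
    refine Eventually.of_forall fun z => (norm_gaussDensity_smul_le hC hb p.1 p.2 z).trans ?_
    exact mul_le_mul_of_nonneg_right hp.le
      (mul_nonneg (gaussDensity_nonneg d z) (by positivity))
  · have := hg.continuous
    exact Continuous.continuousAt (by fun_prop)

lemma polyGrowth_gaussAverage {g : (Fin d → ℝ) → F} (hg : PolyGrowth g) (s : ℝ) :
    PolyGrowth (gaussAverage g s) := by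
  obtain ⟨C, m, hC, hb⟩ := hg.exists_norm_gaussAverage_le
  refine ⟨hg.continuous_gaussAverage.comp (Continuous.prodMk_right s), C * (1 + |s|) ^ m, m,
    by positivity, fun x => (hb s x).trans (le_of_eq ?_)⟩
  rw [mul_pow]
  ring

lemma hasFDerivAt_gaussAverage {g : (Fin d → ℝ) → F} (hd : Differentiable ℝ g)
    (hg : PolyGrowth g) (hg' : PolyGrowth (fderiv ℝ g)) (s : ℝ) (x : Fin d → ℝ) :
    HasFDerivAt (gaussAverage g s) (gaussAverage (fderiv ℝ g) s x) x := by
  obtain ⟨C, m, hC, hb⟩ := hg'.bound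
  refine hasFDerivAt_integral_of_dominated_of_fderiv_le
    (F' := fun y z => gaussDensity d z • fderiv ℝ g (y + s • z))
    (bound := fun z => C * ((1 + (‖x‖ + 1)) * (1 + |s|)) ^ m *
      (gaussDensity d z * (1 + ‖z‖) ^ m))
    (Metric.ball_mem_nhds x one_pos)
    (Eventually.of_forall fun y => aestronglyMeasurable_gaussDensity_smul hg.continuous s y)
    (hg.integrable_gaussDensity_smul s x)
    (aestronglyMeasurable_gaussDensity_smul hg'.continuous s x)
    (Eventually.of_forall fun z y hy => (norm_gaussDensity_smul_le hC hb s y z).trans ?_)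
    ((integrable_gaussDensity_mul_pow d m).const_mul _)
    (Eventually.of_forall fun z y _ => ?_)
  · have hy' : ‖y‖ ≤ ‖x‖ + 1 := by
      linarith [norm_le_norm_add_norm_sub' y x, mem_ball_iff_norm.1 hy]
    refine mul_le_mul_of_nonneg_right ?_ (mul_nonneg (gaussDensity_nonneg d z) (by positivity))
    gcongr
  · exact ((hd (y + s • z)).hasFDerivAt.comp y
      ((hasFDerivAt_id y).add_const (s • z))).const_smul (gaussDensity d z)

lemma fderiv_gaussAverage {g : (Fin d → ℝ) → F} (hd : Differentiable ℝ g)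
    (hg : PolyGrowth g) (hg' : PolyGrowth (fderiv ℝ g)) (s : ℝ) :
    fderiv ℝ (gaussAverage g s) = gaussAverage (fderiv ℝ g) s :=
  funext fun x => (hasFDerivAt_gaussAverage hd hg hg' s x).fderiv

lemma polyGrowthC2_gaussAverage {g : (Fin d → ℝ) → F} (hg : PolyGrowthC2 g) (s : ℝ) :
    PolyGrowthC2 (gaussAverage g s) := by
  have h₁ := fderiv_gaussAverage hg.differentiable hg.growth hg.growth_fderiv s
  have h₂ := fderiv_gaussAverage hg.differentiable_fderiv hg.growth_fderiv
    hg.growth_fderiv_fderiv s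
  refine ⟨?_, polyGrowth_gaussAverage hg.growth s, h₁ ▸ polyGrowth_gaussAverage hg.growth_fderiv s, ?_⟩
  · rw [← one_add_one_eq_two, contDiff_succ_iff_fderiv, h₁]
    refine ⟨fun x =>
      (hasFDerivAt_gaussAverage hg.differentiable hg.growth hg.growth_fderiv s
        x).differentiableAt, fun h => by simp at h, contDiff_one_iff_fderiv.2 ⟨fun x =>
      (hasFDerivAt_gaussAverage hg.differentiable_fderiv hg.growth_fderiv
        hg.growth_fderiv_fderiv s x).differentiableAt, ?_⟩⟩
    rw [h₂]
    exact (polyGrowth_gaussAverage hg.growth_fderiv_fderiv s).continuous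
  · rw [h₁, h₂]
    exact polyGrowth_gaussAverage hg.growth_fderiv_fderiv s

lemma fderiv_gaussAverage_apply {g : (Fin d → ℝ) → F} (hd : Differentiable ℝ g)
    (hg : PolyGrowth g) (hg' : PolyGrowth (fderiv ℝ g)) (s : ℝ) (v : Fin d → ℝ) :
    (fun x => fderiv ℝ (gaussAverage g s) x v) =
      gaussAverage (fun x => fderiv ℝ g x v) s := by
  ext1 x
  rw [fderiv_gaussAverage hd hg hg', gaussAverage, ContinuousLinearMap.integral_apply
    (hg'.integrable_gaussDensity_smul s x)]
  rfl

lemma spatialPD1_gaussAverage {g : (Fin d → ℝ) → ℝ} (hg : PolyGrowthC2 g) (s : ℝ) (i : Fin d) :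
    spatialPD1 d (gaussAverage g s) i = gaussAverage (spatialPD1 d g i) s :=
  fderiv_gaussAverage_apply hg.differentiable hg.growth hg.growth_fderiv s _

lemma spatialPD2_gaussAverage {g : (Fin d → ℝ) → ℝ} (hg : PolyGrowthC2 g) (s : ℝ)
    (i j : Fin d) :
    spatialPD2 d (gaussAverage g s) i j = gaussAverage (spatialPD2 d g i j) s := by
  ext1 x
  have h₁ := spatialPD1_gaussAverage hg s i
  have h₂ := congrFun (fderiv_gaussAverage_apply
    (hg.differentiable_fderiv_apply (Pi.single i 1))
    (hg.growth_fderiv.fderiv_apply (Pi.single i 1))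
    (hg.growth_fderiv_fderiv_apply (Pi.single i 1)) s (Pi.single j 1)) x
  change spatialPD1 d (spatialPD1 d (gaussAverage g s) i) j x = _
  rw [h₁]
  exact h₂

lemma PolyGrowthC2.growth_spatialPD1 {g : (Fin d → ℝ) → ℝ} (hg : PolyGrowthC2 g)
    (i : Fin d) : PolyGrowth (spatialPD1 d g i) :=
  hg.growth_fderiv.fderiv_apply (Pi.single i 1)

lemma PolyGrowthC2.growth_spatialPD2 {g : (Fin d → ℝ) → ℝ} (hg : PolyGrowthC2 g)
    (i j : Fin d) : PolyGrowth (spatialPD2 d g i j) :=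
  (hg.growth_fderiv_fderiv_apply (Pi.single i 1)).fderiv_apply (Pi.single j 1)

lemma PolyGrowthC2.growth_laplacian {g : (Fin d → ℝ) → ℝ} (hg : PolyGrowthC2 g) :
    PolyGrowth (laplacian d g) :=
  PolyGrowth.sum fun i _ => hg.growth_spatialPD2 i i

lemma laplacian_gaussAverage {g : (Fin d → ℝ) → ℝ} (hg : PolyGrowthC2 g) (s : ℝ)
    (x : Fin d → ℝ) :
    laplacian d (gaussAverage g s) x = gaussAverage (laplacian d g) s x := by
  simp only [laplacian, spatialPD2_gaussAverage hg, gaussAverage, Finset.smul_sum]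
  rw [integral_finsetSum _ fun i _ => (hg.growth_spatialPD2 i i).integrable_gaussDensity_smul s x]

/-- Gaussian integration by parts. -/
lemma integral_gaussDensity_mul_coord {h : (Fin d → ℝ) → ℝ} (hd : Differentiable ℝ h)
    (hg : PolyGrowth h) (hg' : PolyGrowth (fderiv ℝ h)) (i : Fin d) (s : ℝ) (x : Fin d → ℝ) :
    ∫ z, gaussDensity d z * (z i * h (x + s • z)) =
      s * gaussAverage (spatialPD1 d h i) s x := by
  have hlin : ∀ z, HasFDerivAt (fun z : Fin d → ℝ => x + s • z)
      (s • ContinuousLinearMap.id ℝ (Fin d → ℝ)) z := fun z =>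
    ((hasFDerivAt_id z).const_smul s).const_add x
  have hcomp : ∀ z, HasFDerivAt (fun z => h (x + s • z))
      ((fderiv ℝ h (x + s • z)).comp (s • ContinuousLinearMap.id ℝ (Fin d → ℝ))) z := fun z =>
    (hd _).hasFDerivAt.comp z (hlin z)
  have hder : ∀ z, fderiv ℝ (fun z => h (x + s • z)) z (Pi.single i 1) =
      s * spatialPD1 d h i (x + s • z) := fun z => by
    rw [(hcomp z).fderiv]
    simp [spatialPD1]
  have hint₁ := hg.integrable_gaussDensity_smul s x
  have hint₂ := (hg'.fderiv_apply (Pi.single i 1)).integrable_gaussDensity_smul s x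
  have hint₃ := hg.integrable_gaussDensity_mul_coord i s x
  have key := integral_smul_fderiv_eq_neg_fderiv_smul_of_integrable (μ := volume)
    (f := fun z => h (x + s • z)) (g := gaussDensity d) (v := Pi.single i 1) ?_ ?_ ?_
    (fun z _ => (hcomp z).differentiableAt)
    (fun z _ => (hasFDerivAt_gaussDensity d z).differentiableAt)
  · simp only [hder, fderiv_gaussDensity_single, smul_eq_mul] at key
    have h₁ : ∀ z : Fin d → ℝ, h (x + s • z) * -(gaussDensity d z * z i) =
        -(gaussDensity d z * (z i * h (x + s • z))) := fun z => by ring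
    have h₂ : ∀ z : Fin d → ℝ, s * spatialPD1 d h i (x + s • z) * gaussDensity d z =
        s * (gaussDensity d z * spatialPD1 d h i (x + s • z)) := fun z => by ring
    simp only [h₁, h₂, integral_neg, integral_const_mul, neg_inj] at key
    exact key
  · refine (hint₂.const_mul s).congr (Eventually.of_forall fun z => ?_)
    simp only [hder, smul_eq_mul, spatialPD1]
    ring
  · refine hint₃.neg.congr (Eventually.of_forall fun z => ?_)
    simp only [fderiv_gaussDensity_single, smul_eq_mul, Pi.neg_apply]
    ring
  · refine hint₁.congr (Eventually.of_forall fun z => ?_)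
    simp only [smul_eq_mul]
    ring


lemma hasDerivAt_gaussAverage {g : (Fin d → ℝ) → ℝ} (hg : PolyGrowthC2 g) (s : ℝ)
    (x : Fin d → ℝ) :
    HasDerivAt (fun s => gaussAverage g s x) (s * gaussAverage (laplacian d g) s x) s := by
  obtain ⟨C, m, hC, hb⟩ := hg.growth_fderiv.bound
  have hder := (hasDerivAt_integral_of_dominated_loc_of_deriv_le
    (F := fun r z => gaussDensity d z • g (x + r • z))
    (F' := fun r z => gaussDensity d z • fderiv ℝ g (x + r • z) z)
    (bound := fun z => C * ((1 + ‖x‖) * (1 + (|s| + 1))) ^ m *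
      (gaussDensity d z * (1 + ‖z‖) ^ (m + 1)))
    (μ := volume) (Metric.ball_mem_nhds s one_pos)
    (Eventually.of_forall fun r =>
      aestronglyMeasurable_gaussDensity_smul hg.growth.continuous r x)
    (hg.growth.integrable_gaussDensity_smul s x) ?_ (Eventually.of_forall fun z r hr => ?_)
    ((integrable_gaussDensity_mul_pow d (m + 1)).const_mul _)
    (Eventually.of_forall fun z r _ => ?_)).2
  · refine hder.congr_deriv ?_
    have h₁ : ∀ z, gaussDensity d z • fderiv ℝ g (x + s • z) z =
        ∑ i, gaussDensity d z * (z i * spatialPD1 d g i (x + s • z)) := fun z => by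
      have hz : z = ∑ i, z i • (Pi.single i 1 : Fin d → ℝ) := by
        ext j
        simp [Pi.single_apply]
      have h₂ : fderiv ℝ g (x + s • z) z = ∑ i, z i * spatialPD1 d g i (x + s • z) := by
        rw [congrArg (fderiv ℝ g (x + s • z)) hz]
        simp [spatialPD1]
      rw [h₂, smul_eq_mul, Finset.mul_sum]
    simp only [h₁]
    rw [integral_finsetSum _ fun i _ =>
      (hg.growth_spatialPD1 i).integrable_gaussDensity_mul_coord i s x]
    have h₃ : ∀ i, ∫ z, gaussDensity d z * (z i * spatialPD1 d g i (x + s • z)) =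
        s * gaussAverage (spatialPD2 d g i i) s x := fun i =>
      integral_gaussDensity_mul_coord (hg.differentiable_fderiv_apply (Pi.single i 1))
        (hg.growth_spatialPD1 i) (hg.growth_fderiv_fderiv_apply (Pi.single i 1)) i s x
    simp only [h₃]
    rw [← Finset.mul_sum, ← laplacian_gaussAverage hg]
    simp only [laplacian, spatialPD2_gaussAverage hg]
  · have := continuous_gaussDensity d
    have := hg.growth_fderiv.continuous
    exact Continuous.aestronglyMeasurable (by fun_prop)
  · have hr' : |r| ≤ |s| + 1 := by
      have h₁ := norm_le_norm_add_norm_sub' r s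
      have h₂ := mem_ball_iff_norm.1 hr
      simp only [Real.norm_eq_abs] at h₁ h₂
      linarith
    rw [norm_smul, Real.norm_of_nonneg (gaussDensity_nonneg d z)]
    calc gaussDensity d z * ‖fderiv ℝ g (x + r • z) z‖
        ≤ gaussDensity d z * (‖fderiv ℝ g (x + r • z)‖ * ‖z‖) :=
          mul_le_mul_of_nonneg_left (ContinuousLinearMap.le_opNorm _ _) (gaussDensity_nonneg d z)
      _ ≤ _ := norm_gaussDensity_smul_le_pow_succ hC hb r x z le_rfl
      _ ≤ _ := by
          refine mul_le_mul_of_nonneg_right ?_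
            (mul_nonneg (gaussDensity_nonneg d z) (by positivity))
          gcongr
  · have hlin : HasDerivAt (fun r : ℝ => x + r • z) z r := by
      simpa using ((hasDerivAt_id r).smul_const z).const_add x
    have hcomp : HasDerivAt (fun r : ℝ => g (x + r • z)) (fderiv ℝ g (x + r • z) z) r :=
      (hg.differentiable _).hasFDerivAt.comp_hasDerivAt r hlin
    exact hcomp.fun_const_smul (gaussDensity d z)

end GaussianAverage

section HeatSemigroup

open Filter Topology

variable {d : ℕ} {F : Type*} [NormedAddCommGroup F] [NormedSpace ℝ F]

/-- The heat semigroup `e^{tΔ}` on `ℝ^d`. -/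
def heatSemigroup (t : ℝ) (g : (Fin d → ℝ) → F) (x : Fin d → ℝ) : F :=
  gaussAverage g √(2 * t) x

lemma heatSemigroup_zero (g : (Fin d → ℝ) → ℝ) : heatSemigroup 0 g = g := by
  ext x
  simp [heatSemigroup, gaussAverage, integral_mul_const, integral_gaussDensity]

lemma PolyGrowth.continuous_heatSemigroup {g : (Fin d → ℝ) → F} (hg : PolyGrowth g) :
    Continuous fun p : ℝ × (Fin d → ℝ) => heatSemigroup p.1 g p.2 :=
  hg.continuous_gaussAverage.comp (g := fun p : ℝ × (Fin d → ℝ) => gaussAverage g p.1 p.2)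
    (f := fun p : ℝ × (Fin d → ℝ) => (√(2 * p.1), p.2)) (by fun_prop)

lemma hasDerivWithinAt_heatSemigroup {g : (Fin d → ℝ) → ℝ} (hg : PolyGrowthC2 g) {t : ℝ}
    (ht : 0 ≤ t) (x : Fin d → ℝ) :
    HasDerivWithinAt (fun s => heatSemigroup s g x) (heatSemigroup t (laplacian d g) x)
      (Ici 0) t := by
  have hpos : ∀ t > 0, HasDerivAt (fun s => heatSemigroup s g x)
      (heatSemigroup t (laplacian d g) x) t := by
    intro t ht
    have h₁ : HasDerivAt (fun s : ℝ => √(2 * s)) (1 / √(2 * t)) t := by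
      have h₂ : HasDerivAt (fun s : ℝ => 2 * s) 2 t := by
        simpa using (hasDerivAt_id t).const_mul 2
      refine (h₂.sqrt (by positivity)).congr_deriv ?_
      field_simp
    have hne : √(2 * t) ≠ 0 := (Real.sqrt_pos.2 (by positivity)).ne'
    refine ((hasDerivAt_gaussAverage hg √(2 * t) x).comp t h₁).congr_deriv ?_
    rw [heatSemigroup]
    field_simp
  have hcont : ∀ {h : (Fin d → ℝ) → ℝ}, PolyGrowth h →
      Continuous fun s => heatSemigroup s h x := fun hh =>
    hh.continuous_heatSemigroup.comp (Continuous.prodMk_left x)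
  rcases ht.eq_or_lt with rfl | ht
  · refine hasDerivWithinAt_Ici_of_tendsto_deriv (s := Ioi 0)
      (fun s hs => (hpos s hs).differentiableAt.differentiableWithinAt)
      (hcont hg.growth).continuousWithinAt self_mem_nhdsWithin ?_
    refine (((hcont hg.growth_laplacian).tendsto 0).mono_left nhdsWithin_le_nhds).congr' ?_
    exact eventually_nhdsWithin_of_forall fun s hs => (hpos s hs).deriv.symm
  · exact (hpos t ht).hasDerivWithinAt

lemma hasDerivWithinAt_heatSemigroup_sub {g : (Fin d → ℝ) → ℝ} (hg : PolyGrowthC2 g)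
    {a b t : ℝ} (ht : t ∈ Icc a b) (x : Fin d → ℝ) :
    HasDerivWithinAt (fun s => heatSemigroup (s - a) g x)
      (heatSemigroup (t - a) (laplacian d g) x) (Icc a b) t := by
  have hsub : HasDerivWithinAt (fun s : ℝ => s - a) 1 (Icc a b) t :=
    ((hasDerivAt_id t).sub_const a).hasDerivWithinAt
  have h₁ := HasDerivWithinAt.scomp (h := fun s : ℝ => s - a)
    (g₁ := fun s => heatSemigroup s g x) t
    (hasDerivWithinAt_heatSemigroup hg (sub_nonneg.2 ht.1) x) hsub
    fun s hs => sub_nonneg.2 hs.1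
  rwa [one_smul] at h₁

lemma polyGrowthC2_heatSemigroup {g : (Fin d → ℝ) → ℝ} (hg : PolyGrowthC2 g) (t : ℝ) :
    PolyGrowthC2 (heatSemigroup t g) :=
  polyGrowthC2_gaussAverage hg _

lemma laplacian_heatSemigroup {g : (Fin d → ℝ) → ℝ} (hg : PolyGrowthC2 g) (t : ℝ)
    (x : Fin d → ℝ) :
    laplacian d (heatSemigroup t g) x = heatSemigroup t (laplacian d g) x :=
  laplacian_gaussAverage hg _ x

lemma isC12On_heatSemigroup_sub {g : (Fin d → ℝ) → ℝ} (hg : PolyGrowthC2 g) {a b : ℝ}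
    (hab : a < b) : IsC12On d a b fun t => heatSemigroup (t - a) g := by
  have hshift : ∀ {h : (Fin d → ℝ) → ℝ}, PolyGrowth h →
      Continuous fun p : ℝ × (Fin d → ℝ) => heatSemigroup (p.1 - a) h p.2 := fun hh =>
    hh.continuous_heatSemigroup.comp
      (g := fun p : ℝ × (Fin d → ℝ) => heatSemigroup p.1 _ p.2)
      (f := fun p : ℝ × (Fin d → ℝ) => (p.1 - a, p.2)) (by fun_prop)
  refine ⟨(hshift hg.growth).continuousOn,
    fun x t ht => (hasDerivWithinAt_heatSemigroup_sub hg ht x).differentiableWithinAt, ?_,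
    fun t _ => (polyGrowthC2_heatSemigroup hg _).contDiff, fun i => ?_, fun i j => ?_⟩
  · refine (hshift hg.growth_laplacian).continuousOn.congr fun p hp => ?_
    exact (hasDerivWithinAt_heatSemigroup_sub hg hp.1 p.2).derivWithin
      (uniqueDiffOn_Icc hab _ hp.1)
  · refine (hshift (hg.growth_spatialPD1 i)).continuousOn.congr
      fun p _ => congrFun (spatialPD1_gaussAverage hg _ i) p.2
  · refine (hshift (hg.growth_spatialPD2 i j)).continuousOn.congr
      fun p _ => congrFun (spatialPD2_gaussAverage hg _ i j) p.2

lemma PolyGrowth.exists_norm_heatSemigroup_le {g : (Fin d → ℝ) → F} (hg : PolyGrowth g)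
    (a b : ℝ) : ∃ (C : ℝ) (m : ℕ), 0 ≤ C ∧ ∀ t ∈ Icc a b, ∀ x,
      ‖heatSemigroup (t - a) g x‖ ≤ C * (1 + ‖x‖) ^ m := by
  obtain ⟨C, m, hC, hb⟩ := hg.exists_norm_gaussAverage_le
  refine ⟨C * (1 + √(2 * (b - a))) ^ m, m, by positivity, fun t ht x => (hb _ x).trans ?_⟩
  rw [mul_pow, abs_of_nonneg (Real.sqrt_nonneg _)]
  calc C * ((1 + ‖x‖) ^ m * (1 + √(2 * (t - a))) ^ m)
      ≤ C * ((1 + ‖x‖) ^ m * (1 + √(2 * (b - a))) ^ m) := by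
        gcongr
        exact ht.2
    _ = _ := by ring

end HeatSemigroup

section SplittingScheme

variable {d : ℕ}

lemma isC12On_const {g : (Fin d → ℝ) → ℝ} (hg : PolyGrowthC2 g) (a b : ℝ) :
    IsC12On d a b fun _ => g := by
  refine ⟨(hg.growth.continuous.comp continuous_snd).continuousOn,
    fun x => differentiableOn_const _, ?_, fun _ _ => hg.contDiff,
    fun i => ((hg.growth_spatialPD1 i).continuous.comp continuous_snd).continuousOn,
    fun i j => ((hg.growth_spatialPD2 i j).continuous.comp continuous_snd).continuousOn⟩
  simp only [derivWithin_fun_const, Pi.zero_apply]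
  exact continuousOn_const

lemma exists_rpow_bound_of_pow_bound {s : Set ℝ} {v : ℝ → (Fin d → ℝ) → ℝ} {C : ℝ} {m : ℕ}
    (hC : 0 ≤ C) (hb : ∀ t ∈ s, ∀ x, ‖v t x‖ ≤ C * (1 + ‖x‖) ^ m) :
    ∃ c q : ℝ, 1 ≤ q ∧ ∀ t ∈ s, ∀ x : Fin d → ℝ, |v t x| ≤ c * (1 + ∑ i, |x i|) ^ q := by
  refine ⟨C, (m + 1 : ℕ), by simp, fun t ht x => (hb t ht x).trans ?_⟩
  have h₁ : ‖x‖ ≤ ∑ i, |x i| :=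
    (pi_norm_le_iff_of_nonneg (Finset.sum_nonneg fun i _ => abs_nonneg _)).2 fun i =>
      Finset.single_le_sum (f := fun i => |x i|) (fun i _ => abs_nonneg _) (Finset.mem_univ i)
  rw [Real.rpow_natCast]
  calc C * (1 + ‖x‖) ^ m ≤ C * (1 + ‖x‖) ^ (m + 1) := by
        gcongr
        · linarith [norm_nonneg x]
        · exact m.le_succ
    _ ≤ C * (1 + ∑ i, |x i|) ^ (m + 1) := by gcongr

/-- Comparison principle for solutions of the heat equation growing at most polynomially. -/
theorem heat_le_of_initial_le (hd : 0 < d) {a b : ℝ}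
    {v w : ℝ → (Fin d → ℝ) → ℝ} (hv : IsC12On d a b v) (hw : IsC12On d a b w)
    (hvg : ∃ c q : ℝ, 1 ≤ q ∧ ∀ t ∈ Icc a b, ∀ x : Fin d → ℝ,
      |v t x| ≤ c * (1 + ∑ i, |x i|) ^ q)
    (hwg : ∃ c q : ℝ, 1 ≤ q ∧ ∀ t ∈ Icc a b, ∀ x : Fin d → ℝ,
      |w t x| ≤ c * (1 + ∑ i, |x i|) ^ q)
    (hvh : ∀ t ∈ Icc a b, ∀ x,
      derivWithin (fun s => v s x) (Icc a b) t = laplacian d (v t) x)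
    (hwh : ∀ t ∈ Icc a b, ∀ x,
      derivWithin (fun s => w s x) (Icc a b) t = laplacian d (w t) x)
    (hinit : ∀ x, v a x ≤ w a x) : ∀ t ∈ Icc a b, ∀ x, v t x ≤ w t x := by
  obtain ⟨c, q, -, hc⟩ := hvg
  obtain ⟨c', q', -, hc'⟩ := hwg
  obtain ⟨C, m, hC, hm⟩ := exists_pow_bound_of_rpow_bound (d := d) c (q := q)
  obtain ⟨C', m', hC', hm'⟩ := exists_pow_bound_of_rpow_bound (d := d) c' (q := q')
  have key := heat_nonpos_of_initial_nonpos hd (a := a) (b := b)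
    (w := fun t x => v t x - 1 * w t x) ?_ ?_ ?_ ?_ ?_
  · intro t ht x
    linarith [key t ht x]
  · exact hv.1.sub (continuousOn_const.mul hw.1)
  · exact fun t ht => (hv.2.2.2.1 t ht).sub (contDiff_const.mul (hw.2.2.2.1 t ht))
  · intro t ht x
    rw [laplacian_sub_const_mul (hv.2.2.2.1 t ht) (hw.2.2.2.1 t ht), ← hvh t ht, ← hwh t ht]
    exact (hv.2.1 x t ht).hasDerivWithinAt.sub ((hw.2.1 x t ht).hasDerivWithinAt.const_mul 1)
  · refine ⟨C + C', m + m', fun t ht x => ?_⟩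
    have h₁ : (1 : ℝ) ≤ 1 + ‖x‖ := by linarith [norm_nonneg x]
    calc |v t x - 1 * w t x| ≤ |v t x| + |w t x| := by
          rw [one_mul]
          exact abs_sub _ _
      _ ≤ C * (1 + ‖x‖) ^ m + C' * (1 + ‖x‖) ^ m' :=
          add_le_add ((hc t ht x).trans (hm x)) ((hc' t ht x).trans (hm' x))
      _ ≤ C * (1 + ‖x‖) ^ (m + m') + C' * (1 + ‖x‖) ^ (m + m') := by
          gcongr
          · exact Nat.le_add_right m m'
          · exact Nat.le_add_left m' m
      _ = _ := by ring
  · intro x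
    linarith [hinit x]

theorem SplittingSol.unique (hd : 0 < d) {T : ℝ} (hT : 0 < T) {f : ℝ → ℝ} {N : ℕ}
    (hN : 0 < N) {u₀ : (Fin d → ℝ) → ℝ} {U V : ℕ → ℝ → (Fin d → ℝ) → ℝ}
    (hU : SplittingSol T f d N u₀ U) (hV : SplittingSol T f d N u₀ V) :
    ∀ n ≤ N, ∀ t ∈ Icc (((n : ℝ) - 1) * T / N) ((n : ℝ) * T / N), ∀ x, V n t x = U n t x := by
  obtain ⟨hU₁, hU₂, hU₃, hU₄, hU₅⟩ := hU
  obtain ⟨hV₁, hV₂, hV₃, hV₄, hV₅⟩ := hV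
  have hN' : (0 : ℝ) < N := Nat.cast_pos.2 hN
  intro n
  induction n with
  | zero =>
    intro _ t ht x
    have ht' : t ∈ Icc (-(T / (N : ℝ))) 0 := by
      simpa [neg_div] using ht
    rw [hU₄ t ht' x, hV₄ t ht' x]
  | succ n ih =>
    intro hn t ht x
    have hcast : ((n + 1 : ℕ) : ℝ) = n + 1 := by push_cast; ring
    have hU₁' := hU₁ (n + 1) hn
    have hV₁' := hV₁ (n + 1) hn
    have hU₂' := hU₂ (n + 1) hn
    have hV₂' := hV₂ (n + 1) hn
    rw [hcast, add_sub_cancel_right] at ht hU₁' hV₁' hU₂' hV₂'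
    have hlt : ∀ y : ℝ, y * T / N < (y + 1) * T / N := fun y => by
      gcongr
      linarith
    have hmem : (n : ℝ) * T / N ∈ Icc (((n : ℝ) - 1) * T / N) ((n : ℝ) * T / N) :=
      ⟨by simpa using (hlt ((n : ℝ) - 1)).le, le_rfl⟩
    have hinit : ∀ x, V (n + 1) ((n : ℝ) * T / N) x = U (n + 1) ((n : ℝ) * T / N) x := by
      intro x
      rw [hV₃ n hn x, hU₃ n hn x, ih (Nat.le_of_succ_le hn) _ hmem x]
    exact le_antisymm
      (heat_le_of_initial_le hd hV₁' hU₁' hV₂' hU₂' (hV₅ n hn) (hU₅ n hn)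
        (fun x => (hinit x).le) t ht x)
      (heat_le_of_initial_le hd hU₁' hV₁' hU₂' hV₂' (hU₅ n hn) (hV₅ n hn)
        (fun x => (hinit x).ge) t ht x)

/-- The splitting-up approximation at the `n`-th grid point for time step `τ`. -/
def splittingState (τ : ℝ) (f : ℝ → ℝ) (u₀ : (Fin d → ℝ) → ℝ) : ℕ → (Fin d → ℝ) → ℝ
  | 0 => u₀
  | n + 1 => heatSemigroup τ fun x =>
      splittingState τ f u₀ n x + τ * f (splittingState τ f u₀ n x)

/-- The time-continuous splitting-up approximations. -/
def splittingScheme (T : ℝ) (f : ℝ → ℝ) (N : ℕ) (u₀ : (Fin d → ℝ) → ℝ) :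
    ℕ → ℝ → (Fin d → ℝ) → ℝ
  | 0 => fun _ => u₀
  | n + 1 => fun t => heatSemigroup (t - n * T / N) fun x =>
      splittingState (T / N) f u₀ n x + T / N * f (splittingState (T / N) f u₀ n x)

lemma splittingScheme_grid (T : ℝ) (f : ℝ → ℝ) (N : ℕ) (u₀ : (Fin d → ℝ) → ℝ) (n : ℕ) :
    splittingScheme T f N u₀ n (n * T / N) = splittingState (T / N) f u₀ n := by
  cases n with
  | zero => rfl
  | succ n =>
    simp only [splittingScheme, splittingState]
    congr 1
    push_cast
    ring

lemma polyGrowthC2_euler {τ : ℝ} {f : ℝ → ℝ} (hf : ContDiff ℝ 2 f)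
    (hf' : ∃ K : ℝ, ∀ y : ℝ, |deriv f y| ≤ K) (hf'' : PolyGrowth (deriv (deriv f)))
    {g : (Fin d → ℝ) → ℝ} (hg : PolyGrowthC2 g) :
    PolyGrowthC2 fun x => g x + τ * f (g x) := by
  obtain ⟨K, hK⟩ := hf'
  have hd : Differentiable ℝ f := hf.differentiable (by norm_num)
  have hf₁ : ContDiff ℝ 1 (deriv f) :=
    ContDiff.deriv' (n := 1) (by simpa [one_add_one_eq_two] using hf)
  have hd' : Differentiable ℝ (deriv f) := hf₁.differentiable (by norm_num)
  have h₁ : deriv (fun y => y + τ * f y) = fun y => 1 + τ * deriv f y :=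
    funext fun y => ((hasDerivAt_id y).add ((hd y).hasDerivAt.const_mul τ)).deriv
  have h₂ : deriv (deriv fun y => y + τ * f y) = fun y => τ * deriv (deriv f) y := by
    rw [h₁]
    exact funext fun y => (((hd' y).hasDerivAt.const_mul τ).const_add 1).deriv
  have hp₁ : PolyGrowth (deriv f) :=
    (PolyGrowth.const K).of_norm_le hf₁.continuous (K := 1) fun y => by
      simpa using (hK y).trans (le_abs_self K)
  refine PolyGrowthC2.comp (φ := fun y => y + τ * f y)
    (contDiff_id.add (contDiff_const.mul hf))
    (PolyGrowth.id.add ((PolyGrowth.const τ).smul (.of_deriv_bounded hd hK))) ?_ ?_ hg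
  · rw [h₁]
    exact (PolyGrowth.const 1).add ((PolyGrowth.const τ).smul hp₁)
  · rw [h₂]
    exact (PolyGrowth.const τ).smul hf''

lemma polyGrowthC2_splittingState {τ : ℝ} {f : ℝ → ℝ} (hf : ContDiff ℝ 2 f)
    (hf' : ∃ K : ℝ, ∀ y : ℝ, |deriv f y| ≤ K) (hf'' : PolyGrowth (deriv (deriv f)))
    {u₀ : (Fin d → ℝ) → ℝ} (hu₀ : PolyGrowthC2 u₀) (n : ℕ) :
    PolyGrowthC2 (splittingState τ f u₀ n) := by
  induction n with
  | zero => exact hu₀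
  | succ n ih => exact polyGrowthC2_heatSemigroup (polyGrowthC2_euler hf hf' hf'' ih) τ

theorem splittingSol_splittingScheme {T : ℝ} (hT : 0 < T) {f : ℝ → ℝ} (hf : ContDiff ℝ 2 f)
    (hf' : ∃ K : ℝ, ∀ y : ℝ, |deriv f y| ≤ K) (hf'' : PolyGrowth (deriv (deriv f)))
    {N : ℕ} (hN : 0 < N) {u₀ : (Fin d → ℝ) → ℝ} (hu₀ : PolyGrowthC2 u₀) :
    SplittingSol T f d N u₀ (splittingScheme T f N u₀) := by
  have hN' : (0 : ℝ) < N := Nat.cast_pos.2 hN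
  have hstep : ∀ n : ℕ, PolyGrowthC2 fun x : Fin d → ℝ => splittingState (T / N) f u₀ n x +
      T / N * f (splittingState (T / N) f u₀ n x) := fun n =>
    polyGrowthC2_euler hf hf' hf'' (polyGrowthC2_splittingState hf hf' hf'' hu₀ n)
  have hcast : ∀ n : ℕ, ((n + 1 : ℕ) : ℝ) - 1 = n := fun n => by push_cast; ring
  have hlt : ∀ n : ℕ, (n : ℝ) * T / N < ((n : ℝ) + 1) * T / N := fun n => by
    gcongr
    linarith
  refine ⟨fun n _ => ?_, fun n _ => ?_, fun n _ x => ?_, fun _ _ _ => rfl,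
    fun n _ t ht x => ?_⟩
  · cases n with
    | zero => exact isC12On_const hu₀ _ _
    | succ n =>
      rw [hcast]
      exact isC12On_heatSemigroup_sub (hstep n) (by simpa using hlt n)
  · cases n with
    | zero =>
      obtain ⟨C, m, hC, hb⟩ := hu₀.growth.bound
      exact exists_rpow_bound_of_pow_bound hC fun _ _ => hb
    | succ n =>
      rw [hcast]
      obtain ⟨C, m, hC, hb⟩ := (hstep n).growth.exists_norm_heatSemigroup_le
        (n * T / N) ((n + 1 : ℕ) * T / N)
      exact exists_rpow_bound_of_pow_bound hC hb
  · rw [splittingScheme_grid]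
    simp [splittingScheme, heatSemigroup_zero]
  · simp only [splittingScheme]
    rw [(hasDerivWithinAt_heatSemigroup_sub (hstep n) ht x).derivWithin
      (uniqueDiffOn_Icc (hlt n) _ ht), laplacian_heatSemigroup (hstep n)]

end SplittingScheme

/-- **Existence and uniqueness of the splitting-up approximations for semilinear heat
equations.** -/
theorem splitting_exists_unique
    (T p : ℝ) (hT : 0 < T) (hp : 1 ≤ p)
    (f : ℝ → ℝ) (hf : ContDiff ℝ 2 f)
    (hf' : ∃ K : ℝ, ∀ y : ℝ, |deriv f y| ≤ K)
    (u : (d : ℕ) → ℝ → (Fin d → ℝ) → ℝ)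
    (hu : ∀ d : ℕ, IsC12On d 0 T (u d))
    (hpde : ∀ d : ℕ, ∀ t ∈ Icc (0:ℝ) T, ∀ x : Fin d → ℝ,
      derivWithin (fun s => u d s x) (Icc (0:ℝ) T) t
        = laplacian d (u d t) x + f (u d t x))
    (hgrowth : ∀ (d : ℕ) (hd : 0 < d) (i j : Fin d), ∃ C : ℝ,
      ∀ t ∈ Icc (0:ℝ) T, ∀ x : Fin d → ℝ,
        |u d t x| + |spatialPD1 d (u d t) i x| + |spatialPD2 d (u d t) i j x|
            + |derivWithin (fun s => u d s x) (Icc (0:ℝ) T) t|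
            + |deriv (deriv f) (x ⟨0, hd⟩)|
          ≤ C * (1 + ∑ k, |x k|) ^ p) :
    ∀ (d N : ℕ), 0 < d → 0 < N →
      ∃ U : ℕ → ℝ → (Fin d → ℝ) → ℝ,
        SplittingSol T f d N (u d 0) U ∧
          ∀ V : ℕ → ℝ → (Fin d → ℝ) → ℝ, SplittingSol T f d N (u d 0) V →
            ∀ n ≤ N, ∀ t ∈ Icc (((n : ℝ) - 1) * T / N) ((n : ℝ) * T / N),
              ∀ x : Fin d → ℝ, V n t x = U n t x := by
  intro d N hd hN
  have h0 : (0 : ℝ) ∈ Icc (0 : ℝ) T := ⟨le_rfl, hT.le⟩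
  have hf'' : PolyGrowth (deriv (deriv f)) := by
    obtain ⟨C, hC⟩ := hgrowth 1 one_pos 0 0
    have hf₁ : ContDiff ℝ 1 (deriv f) :=
      ContDiff.deriv' (n := 1) (by simpa [one_add_one_eq_two] using hf)
    have h₁ : PolyGrowth fun x : Fin 1 → ℝ => deriv (deriv f) (x 0) := by
      refine .of_rpow_bound ((hf₁.continuous_deriv (by norm_num)).comp (continuous_apply (0 : Fin 1)))
        (C := C) (q := p) fun x => ?_
      refine le_trans ?_ (hC 0 h0 x)
      exact le_add_of_nonneg_left (by positivity)
    obtain ⟨C', m, hC', hb⟩ := h₁.bound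
    refine ⟨hf₁.continuous_deriv (by norm_num), C', m, hC', fun y => ?_⟩
    simpa using hb fun _ => y
  have hC2 : ContDiff ℝ 2 (u d 0) := (hu d).2.2.2.1 0 h0
  have hu₀ : PolyGrowthC2 (u d 0) := by
    have hi : Fin d := ⟨0, hd⟩
    have hc₁ : ∀ i, Continuous (spatialPD1 d (u d 0) i) := fun i =>
      (spatialPD1_differentiable hC2 i).continuous
    have hc₂ : ∀ i j, Continuous (spatialPD2 d (u d 0) i j) := fun i j =>
      ((((hC2.fderiv_right (m := 1) (by norm_num)).clm_apply
        contDiff_const).continuous_fderiv (by norm_num)).clm_apply continuous_const)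
    refine .of_spatialPD hC2 ?_ (fun i => ?_) fun i j => ?_
    · obtain ⟨C, hC⟩ := hgrowth d hd hi hi
      refine .of_rpow_bound hC2.continuous fun x => le_trans ?_ (hC 0 h0 x)
      rw [Real.norm_eq_abs, add_assoc, add_assoc, add_assoc]
      exact le_add_of_nonneg_right (by positivity)
    · obtain ⟨C, hC⟩ := hgrowth d hd i i
      refine .of_rpow_bound (hc₁ i) fun x => le_trans ?_ (hC 0 h0 x)
      rw [Real.norm_eq_abs, add_assoc, add_assoc, add_assoc, add_left_comm]
      exact le_add_of_nonneg_right (by positivity)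
    · obtain ⟨C, hC⟩ := hgrowth d hd i j
      refine .of_rpow_bound (hc₂ i j) fun x => le_trans ?_ (hC 0 h0 x)
      rw [Real.norm_eq_abs]
      linarith [abs_nonneg (u d 0 x), abs_nonneg (spatialPD1 d (u d 0) i x),
        abs_nonneg (derivWithin (fun s => u d s x) (Icc (0 : ℝ) T) 0),
        abs_nonneg (deriv (deriv f) (x ⟨0, hd⟩))]
  have hU := splittingSol_splittingScheme hT hf hf' hf'' hN hu₀
  exact ⟨_, hU, fun V hV => hU.unique hd hT hN hV⟩

end
end
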